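/- arXiv:2110.12452 — 8 statements merged into one kernel-verified Lean document; each statement's English description precedes it below -/
import Mathlib

section
/- For every positive integer d there exists a deterministic 1-aware population protocol computing the threshold predicate R_d whose number of states |Q| is at most ⌊log₂ d⌋ + min{e(d), z(d−1)} + 3 (with the convention z(d−1) = 0 when d = 1). -/
/-- A population protocol `⟨Q, Q₀, Q₁, q_init, δ⟩` over a set of states `Q`. -/
structure PopulationProtocol (Q : Type) where
  Q0 : Set Q
  Q1 : Set Q
  qinit : Q
  delta : Q → Q → Set (Q × Q)
  union_eq : Q0 ∪ Q1 = Set.univ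
  inter_eq : Q0 ∩ Q1 = ∅
  delta_nonempty : ∀ q1 q2 : Q, (delta q1 q2).Nonempty

namespace PopulationProtocol

variable {Q : Type} (P : PopulationProtocol Q)

/-- A protocol is deterministic if every value of `δ` is a singleton. -/
def Deterministic : Prop := ∀ q1 q2 : Q, ∃ p : Q × Q, P.delta q1 q2 = {p}

/-- The initial `n`-size configuration `I_n`: all agents in the initial state. -/
def initConfig (n : ℕ) : Fin n → Q := fun _ => P.qinit

/-- `(C1, C2)` is a transition: two distinct agents interact according to `δ`,
all other agents keep their state. -/
def Transition {n : ℕ} (C1 C2 : Fin n → Q) : Prop :=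
  ∃ i j : Fin n, i ≠ j ∧ (C2 i, C2 j) ∈ P.delta (C1 i) (C1 j) ∧
    ∀ k : Fin n, k ≠ i → k ≠ j → C2 k = C1 k

/-- `D` is reachable from `C` via a finite sequence of transitions. -/
def Reachable {n : ℕ} (C D : Fin n → Q) : Prop :=
  Relation.ReflTransGen P.Transition C D

/-- An execution: an infinite sequence of configurations starting from `I_n`,
each consecutive pair being a transition. -/
def IsExecution {n : ℕ} (E : ℕ → Fin n → Q) : Prop :=
  E 0 = P.initConfig n ∧ ∀ i : ℕ, P.Transition (E i) (E (i + 1))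

/-- Fairness: whenever `C` occurs infinitely often and `D` is reachable from `C`,
`D` also occurs infinitely often. -/
def Fair {n : ℕ} (E : ℕ → Fin n → Q) : Prop :=
  ∀ C D : Fin n → Q, (∀ N : ℕ, ∃ i ≥ N, E i = C) → P.Reachable C D →
    (∀ N : ℕ, ∃ i ≥ N, E i = D)

/-- `Π` is a 1-aware population protocol computing the predicate `R`. -/
def Computes1Aware (R : ℕ → Bool) : Prop :=
  ∀ n : ℕ, 0 < n →
    (R n = false →
      ∀ C : Fin n → Q, P.Reachable (P.initConfig n) C → ∀ i : Fin n, C i ∈ P.Q0) ∧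
    (R n = true →
      ∀ E : ℕ → Fin n → Q, P.IsExecution E → P.Fair E →
        ∃ i0 : ℕ, ∀ i ≥ i0, ∀ a : Fin n, E i a ∈ P.Q1)

/-- A state `q` can occur from a configuration `C`. -/
def CanOccur {n : ℕ} (C : Fin n → Q) (q : Q) : Prop :=
  ∃ D : Fin n → Q, P.Reachable C D ∧ ∃ i : Fin n, D i = q

/-- `f q`: the minimal `n ∈ ℤ⁺` such that `q` can occur from `I_n`
(`⊤` if there is no such `n`). -/
noncomputable def f (q : Q) : ℕ∞ :=
  sInf {m : ℕ∞ | ∃ n : ℕ, m = (n : ℕ∞) ∧ 0 < n ∧ P.CanOccur (P.initConfig n) q}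

/-- `f(Q)`: the set of finite values of `f`. -/
def fQ : Set ℕ := {n : ℕ | ∃ q : Q, P.f q = (n : ℕ∞)}

end PopulationProtocol

/-- The threshold predicate `R_d(n) = 1 ↔ n ≥ d`. -/
def threshold (d : ℕ) : ℕ → Bool := fun n => decide (d ≤ n)

/-- `e(m)`: the number of `1`s in the binary representation of `m`. -/
def onesCount (m : ℕ) : ℕ := (Nat.digits 2 m).count 1

/-- `z(m)`: the number of `0`s in the binary representation of `m`
(no leading zeros). -/
def zerosCount (m : ℕ) : ℕ := (Nat.digits 2 m).count 0

namespace UB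

/-- States of the protocol. -/
inductive St (L : ℕ) (T : Type) where
  | acc : St L T
  | low (s : Option (Fin L)) : St L T
  | lead (t : T) : St L T

def St.equiv (L : ℕ) (T : Type) : St L T ≃ Option (Option (Fin L) ⊕ T) where
  toFun
    | .acc => none
    | .low s => some (.inl s)
    | .lead t => some (.inr t)
  invFun
    | none => .acc
    | some (.inl s) => .low s
    | some (.inr t) => .lead t
  left_inv := by intro x; cases x <;> rfl
  right_inv := by intro x; rcases x with _ | _ | _ <;> rfl

/-- value of a low state -/
def val {L : ℕ} : Option (Fin L) → ℕ
  | none => 0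
  | some i => 2 ^ (i : ℕ)

def zer {L : ℕ} : Option (Fin L) → ℕ
  | none => 1
  | some _ => 0

structure Data (d L : ℕ) (T : Type) where
  w : T → ℕ
  m : T → ℕ
  t0 : T
  act : T → Option (Fin L) → Option (T × Option (Fin L))
  hd : 2 ^ L < d
  w0 : w t0 = 2 ^ L
  wge : ∀ t, d ≤ w t + 2 ^ L
  wtwo : d ≤ 2 ^ (L + 1)
  act_none : ∀ t s, act t s = none → d ≤ w t + val s
  act_some : ∀ t s t' s', act t s = some (t', s') → w t + val s = w t' + val s'
  act_meas : ∀ t s t' s', act t s = some (t', s') → (t', s') ≠ (t, s) →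
    2 * m t + zer s < 2 * m t' + zer s'
  stuck : ∀ t (P : Finset (Fin L)), (∀ i ∈ P, act t (some i) = some (t, some i)) →
    act t none = some (t, none) → w t + ∑ i ∈ P, 2 ^ (i : ℕ) < d

variable {d L : ℕ} {T : Type}

namespace Data
variable (X : Data d L T)

def pw (i : ℕ) : St L T := if h : i < L then .low (some ⟨i, h⟩) else .lead X.t0

def del : St L T → St L T → St L T × St L T
  | .acc, _ => (.acc, .acc)
  | _, .acc => (.acc, .acc)
  | .lead _, .lead _ => (.acc, .acc)
  | .lead t, .low s => match X.act t s with
    | none => (.acc, .acc)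
    | some (t', s') => (.lead t', .low s')
  | .low s, .lead t => match X.act t s with
    | none => (.acc, .acc)
    | some (t', s') => (.low s', .lead t')
  | .low (some i), .low (some j) =>
      if i = j then (X.pw (i + 1), .low none) else (.low (some i), .low (some j))
  | .low none, .low s => (.low none, .low s)
  | .low s, .low none => (.low s, .low none)

def prot : PopulationProtocol (St L T) where
  Q0 := {q | q ≠ .acc}
  Q1 := {.acc}
  qinit := X.pw 0
  delta := fun a b => {X.del a b}
  union_eq := by ext q; simp; tauto
  inter_eq := by ext q; simp
  delta_nonempty := by intro a b; simp

def W : St L T → ℕ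
  | .acc => 0
  | .low s => val s
  | .lead t => X.w t

def N : St L T → ℕ
  | .lead _ => 1
  | _ => 0

def mu : St L T → ℕ
  | .acc => 0
  | .low s => zer s
  | .lead t => 2 * X.m t

theorem pw_ne (i : ℕ) : X.pw i ≠ .acc := by
  unfold pw; split <;> simp

theorem W_pw (i : ℕ) (h : i ≤ L) : X.W (X.pw i) = 2 ^ i := by
  unfold pw; split
  · simp [W, val]
  · have : i = L := by omega
    simp [W, X.w0, this]

theorem N_pw_le (i : ℕ) : N (X.pw i) ≤ 1 := by
  unfold pw; split <;> simp [N]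

end Data

theorem sum_change {Q : Type} {n : ℕ} (f : Q → ℕ) (C D : Fin n → Q) (i j : Fin n) (hij : i ≠ j)
    (h : ∀ k, k ≠ i → k ≠ j → D k = C k) :
    ∑ a, f (D a) + f (C i) + f (C j) = ∑ a, f (C a) + f (D i) + f (D j) := by
  have key : ∀ F : Fin n → Q, ∑ a, f (F a) =
      f (F i) + (f (F j) + ∑ a ∈ (Finset.univ.erase i).erase j, f (F a)) := by
    intro F
    rw [← Finset.add_sum_erase _ _ (Finset.mem_univ i),
      ← Finset.add_sum_erase (Finset.univ.erase i) _ (show j ∈ _ by simp [hij.symm])]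
  rw [key C, key D]
  have : ∑ a ∈ (Finset.univ.erase i).erase j, f (D a) =
      ∑ a ∈ (Finset.univ.erase i).erase j, f (C a) := by
    apply Finset.sum_congr rfl
    intro a ha
    simp at ha
    rw [h a ha.2 ha.1]
  omega

theorem two_le_sum {n : ℕ} (f : Fin n → ℕ) (i j : Fin n) (hij : i ≠ j) :
    f i + f j ≤ ∑ a, f a := by
  rw [← Finset.sum_pair hij]
  exact Finset.sum_le_sum_of_subset (Finset.subset_univ _)

namespace Data
variable (X : Data d L T)

/-- local analysis of one interaction -/
theorem del_spec (a b : St L T) (ha : a ≠ .acc) (hb : b ≠ .acc) :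
    (X.del a b = (.acc, .acc) ∧ (d ≤ X.W a + X.W b ∨ N a + N b = 2)) ∨
    ((X.del a b).1 ≠ .acc ∧ (X.del a b).2 ≠ .acc ∧
      X.W (X.del a b).1 + X.W (X.del a b).2 = X.W a + X.W b ∧
      (N (X.del a b).1 + N (X.del a b).2 = N a + N b ∨
       (N a + N b = 0 ∧ (X.del a b).1 = .lead X.t0 ∧ (X.del a b).2 = .low none))) := by
  rcases a with _ | s | t
  · simp at ha
  · rcases b with _ | s' | t'
    · simp at hb
    · rcases s with _ | i
      · simp [del, N]
      · rcases s' with _ | j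
        · simp [del, N]
        · by_cases hij : i = j
          · subst hij
            right
            have hi := i.2
            simp only [del, if_true]
            refine ⟨X.pw_ne _, by simp, ?_, ?_⟩
            · rw [X.W_pw _ (by omega)]; simp [W, val, pow_succ]; ring
            · unfold pw; split <;> simp [N]
          · simp [del, N, hij]
    · rcases h : X.act t' s with _ | ⟨t2, s2⟩
      · left
        have := X.act_none _ _ h
        simp [del, h, W]; left; omega
      · right
        have := X.act_some _ _ _ _ h
        simp [del, h, W, N]; omega
  · rcases b with _ | s' | t'
    · simp at hb
    · rcases h : X.act t s' with _ | ⟨t2, s2⟩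
      · left
        have := X.act_none _ _ h
        simp [del, h, W]; left; omega
      · right
        have := X.act_some _ _ _ _ h
        simp [del, h, W, N]; omega
    · left; simp [del, N]

theorem acc_del (a b : St L T) (h : a = .acc ∨ b = .acc) : X.del a b = (.acc, .acc) := by
  rcases h with rfl | rfl
  · simp [del]
  · cases a <;> simp [del]

theorem trans_iff {n : ℕ} (C D : Fin n → St L T) : X.prot.Transition C D ↔
    ∃ i j : Fin n, i ≠ j ∧ D i = (X.del (C i) (C j)).1 ∧ D j = (X.del (C i) (C j)).2 ∧
      ∀ k, k ≠ i → k ≠ j → D k = C k := by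
  simp only [PopulationProtocol.Transition, prot, Set.mem_singleton_iff, Prod.ext_iff, and_assoc]

theorem sumW_init (n : ℕ) : ∑ a, X.W (X.prot.initConfig n a) = n := by
  simp [PopulationProtocol.initConfig, prot, X.W_pw 0 (Nat.zero_le _)]

theorem safe {n : ℕ} (hn : n < d) (C : Fin n → St L T)
    (h : X.prot.Reachable (X.prot.initConfig n) C) :
    (∀ a, C a ≠ .acc) ∧ ∑ a, X.W (C a) = n ∧ ∑ a, N (C a) ≤ 1 := by
  induction h with
  | refl =>
    refine ⟨fun a => X.pw_ne 0, X.sumW_init n, ?_⟩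
    by_cases hL : 0 < L
    · simp [PopulationProtocol.initConfig, prot, pw, hL, N]
    · have : L = 0 := by omega
      subst this
      have := X.wtwo
      simp [PopulationProtocol.initConfig, prot, pw, N]
      omega
  | tail _ hs ih =>
    rename_i B D _
    obtain ⟨h1, h2, h3⟩ := ih
    obtain ⟨i, j, hij, hi, hj, hk⟩ := (X.trans_iff _ _).1 hs
    have sW := sum_change X.W B D i j hij hk
    have sN := sum_change N B D i j hij hk
    have bW := two_le_sum (fun a => X.W (B a)) i j hij
    have bN := two_le_sum (fun a => N (B a)) i j hij
    rcases X.del_spec (B i) (B j) (h1 i) (h1 j) with ⟨_, h⟩ | ⟨e1, e2, e3, e4⟩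
    · omega
    · rw [← hi, ← hj] at e3 e4
      rw [← hi] at e1
      rw [← hj] at e2
      have hW : ∑ a, X.W (D a) = n := by omega
      refine ⟨?_, hW, ?_⟩
      · intro a
        by_cases hai : a = i
        · rwa [hai]
        by_cases haj : a = j
        · rwa [haj]
        rw [hk a hai haj]; exact h1 a
      · rcases e4 with e4 | ⟨e4, e5, e6⟩
        · omega
        · by_contra hcon
          have hne : ∑ a, N (B a) ≠ 0 := by
            intro h0
            have : N (D i) + N (D j) = 1 := by rw [e5, e6]; rfl
            omega
          obtain ⟨k, -, hkk⟩ := Finset.exists_ne_zero_of_sum_ne_zero hne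
          have hki : k ≠ i := by rintro rfl; omega
          have hkj : k ≠ j := by rintro rfl; omega
          have bW := two_le_sum (fun a => X.W (D a)) i k (Ne.symm hki)
          simp only [hk k hki hkj, e5] at bW
          rcases hB : B k with _ | s | t
          · simp [hB, N] at hkk
          · simp [hB, N] at hkk
          · rw [hB] at bW
            have := X.wge t
            rw [hW] at bW
            simp only [W, X.w0] at bW
            omega

theorem live_inv {n : ℕ} (C : Fin n → St L T)
    (h : X.prot.Reachable (X.prot.initConfig n) C) :
    (∃ a, C a = .acc) ∨ ∑ a, X.W (C a) = n := by
  induction h with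
  | refl => exact Or.inr (X.sumW_init n)
  | tail _ hs ih =>
    rename_i B D _
    obtain ⟨i, j, hij, hi, hj, hk⟩ := (X.trans_iff _ _).1 hs
    by_cases hB : ∃ a, B a = .acc
    · obtain ⟨a, ha⟩ := hB
      left
      by_cases hai : a = i
      · subst hai
        exact ⟨a, by rw [hi, X.acc_del _ _ (Or.inl ha)]⟩
      by_cases haj : a = j
      · subst haj
        exact ⟨a, by rw [hj, X.acc_del _ _ (Or.inr ha)]⟩
      exact ⟨a, by rw [hk a hai haj, ha]⟩
    · have ih := ih.resolve_left hB
      push Not at hB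
      have sW := sum_change X.W B D i j hij hk
      rcases X.del_spec (B i) (B j) (hB i) (hB j) with ⟨e, h⟩ | ⟨e1, e2, e3, e4⟩
      · left; exact ⟨i, by rw [hi, e]⟩
      · right; rw [← hi, ← hj] at e3; omega

/-- result of interaction i j -/
noncomputable def step {n : ℕ} (C : Fin n → St L T) (i j : Fin n) : Fin n → St L T :=
  Function.update (Function.update C i (X.del (C i) (C j)).1) j (X.del (C i) (C j)).2

theorem step_spec {n : ℕ} (C : Fin n → St L T) (i j : Fin n) (hij : i ≠ j) :
    X.prot.Transition C (X.step C i j) ∧ X.step C i j i = (X.del (C i) (C j)).1 ∧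
    X.step C i j j = (X.del (C i) (C j)).2 ∧ ∀ k, k ≠ i → k ≠ j → X.step C i j k = C k := by
  have h1 : X.step C i j i = (X.del (C i) (C j)).1 := by simp [step, hij]
  have h2 : X.step C i j j = (X.del (C i) (C j)).2 := by simp [step]
  have h3 : ∀ k, k ≠ i → k ≠ j → X.step C i j k = C k := by
    intro k hi hj; simp [step, hi, hj]
  exact ⟨(X.trans_iff _ _).2 ⟨i, j, hij, h1, h2, h3⟩, h1, h2, h3⟩

def lowv (g : Fin L → ℕ) : St L T → ℕ
  | .low (some i) => g i
  | _ => 0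

open Classical in
theorem low_sum {n : ℕ} (C : Fin n → St L T) (g : Fin L → ℕ)
    (h : ∀ i j x, C i = .low (some x) → C j = .low (some x) → i = j) :
    ∑ a, lowv g (C a) ≤ ∑ x ∈ Finset.univ.filter (fun x => ∃ a, C a = .low (some x)), g x := by
  have e : ∀ a, lowv g (C a) = ∑ x, if C a = .low (some x) then g x else 0 := by
    intro a
    rcases C a with _ | (_ | i) | t <;> simp [lowv]
  simp only [e]
  rw [Finset.sum_comm, Finset.sum_filter]
  apply Finset.sum_le_sum
  intro x _
  split
  · next hx =>
    obtain ⟨a, ha⟩ := hx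
    rw [Finset.sum_eq_single a]
    · simp [ha]
    · intro b _ hb
      rw [if_neg]
      intro hb'
      exact hb (h _ _ _ hb' ha)
    · simp
  · next hx =>
    apply le_of_eq
    apply Finset.sum_eq_zero
    intro a _
    rw [if_neg]
    intro h'
    exact hx ⟨a, h'⟩

theorem sum_pow_fin (P : Finset (Fin L)) (k : ℕ) (h : ∀ i ∈ P, (i : ℕ) < k) :
    ∑ i ∈ P, 2 ^ (i : ℕ) < 2 ^ k := by
  have h1 : ∑ i ∈ P, 2 ^ (i : ℕ) = ∑ i ∈ P.map Fin.valEmbedding, 2 ^ i := by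
    rw [Finset.sum_map]; rfl
  rw [h1]
  apply Nat.geomSum_lt (le_refl 2)
  intro i hi
  simp only [Finset.mem_map, Fin.valEmbedding_apply] at hi
  obtain ⟨a, ha, rfl⟩ := hi
  exact h a ha

open Classical in
/-- Progress. -/
theorem progress {n : ℕ} (hn : d ≤ n) (C : Fin n → St L T) (hC : ∀ a, C a ≠ .acc)
    (hW : ∑ a, X.W (C a) = n) : ∃ D, X.prot.Transition C D ∧
      ((∃ a, D a = .acc) ∨ ((∀ a, D a ≠ .acc) ∧ ∑ a, X.W (D a) = n ∧
        ∑ a, X.mu (C a) < ∑ a, X.mu (D a))) := by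
  by_contra hno
  have main : ∀ i j, i ≠ j → X.del (C i) (C j) ≠ (.acc, .acc) ∧
      X.mu (X.del (C i) (C j)).1 + X.mu (X.del (C i) (C j)).2 ≤ X.mu (C i) + X.mu (C j) := by
    intro i j hij
    obtain ⟨h1, h2, h3, h4⟩ := X.step_spec C i j hij
    by_contra hcon
    apply hno
    refine ⟨_, h1, ?_⟩
    rcases X.del_spec (C i) (C j) (hC i) (hC j) with ⟨e, h⟩ | ⟨e1, e2, e3, e4⟩
    · left; exact ⟨i, by rw [h2, e]⟩
    · right
      have sW := sum_change X.W C _ i j hij h4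
      have sM := sum_change X.mu C _ i j hij h4
      rw [h2, h3] at sW sM
      have hcon : ¬ (X.mu (X.del (C i) (C j)).1 + X.mu (X.del (C i) (C j)).2 ≤
          X.mu (C i) + X.mu (C j)) := by
        intro h'; apply hcon; refine ⟨?_, h'⟩
        intro h''; rw [h''] at e1; exact e1 rfl
      refine ⟨?_, by omega, by omega⟩
      intro a
      by_cases hai : a = i
      · rw [hai, h2]; exact e1
      by_cases haj : a = j
      · rw [haj, h3]; exact e2
      rw [h4 a hai haj]; exact hC a
  have hlead : ∀ i j t t', C i = .lead t → C j = .lead t' → i = j := by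
    intro i j t t' hi hj
    by_contra hij
    exact (main i j hij).1 (by simp [hi, hj, del])
  have hlow : ∀ i j x, C i = .low (some x) → C j = .low (some x) → i = j := by
    intro i j x hi hj
    by_contra hij
    have := (main i j hij).2
    simp [hi, hj, del, mu, zer] at this
  have hact : ∀ i j t s, C i = .lead t → C j = .low s → X.act t s = some (t, s) := by
    intro i j t s hi hj
    have hij : i ≠ j := by rintro rfl; rw [hi] at hj; simp at hj
    have := main i j hij
    rw [hi, hj] at this
    rcases h : X.act t s with _ | ⟨t2, s2⟩
    · simp [del, h] at this
    · by_contra hne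
      have h2 := X.act_meas _ _ _ _ h (by intro h'; exact hne (by rw [h']))
      simp only [del, h, mu] at this
      omega
  have s1 := low_sum C (fun i => 2 ^ (i : ℕ)) hlow
  have s2 := low_sum C (fun i => 1) hlow
  have hpow := sum_pow_fin (Finset.univ.filter (fun x : Fin L => ∃ a, C a = .low (some x))) L
    (fun i _ => i.2)
  have hd := X.hd
  by_cases hl : ∃ a t, C a = .lead t
  · obtain ⟨a, t, ha⟩ := hl
    have hsum : ∑ b, X.W (C b) = X.w t + ∑ b, lowv (fun i => 2 ^ (i : ℕ)) (C b) := by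
      have : ∀ b, X.W (C b) = (if b = a then X.w t else 0) +
          lowv (fun i => 2 ^ (i : ℕ)) (C b) := by
        intro b
        by_cases hb : b = a
        · subst hb; simp [ha, W, lowv]
        · rcases hCb : C b with _ | (_ | i) | t'
          · exact absurd hCb (hC b)
          · simp [W, lowv, val, hb]
          · simp [W, lowv, val, hb]
          · exact absurd (hlead _ _ _ _ hCb ha) hb
      simp only [this, Finset.sum_add_distrib]
      simp
    have hz : ∃ b, C b = .low none := by
      by_contra hz
      push Not at hz
      have : ∀ b, 1 = (if b = a then 1 else 0) + lowv (fun i => 1) (C b) := by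
        intro b
        by_cases hb : b = a
        · subst hb; simp [ha, lowv]
        · rcases hCb : C b with _ | (_ | i) | t'
          · exact absurd hCb (hC b)
          · exact absurd hCb (hz b)
          · simp [lowv, hb]
          · exact absurd (hlead _ _ _ _ hCb ha) hb
      have h1 : ∑ b : Fin n, 1 = 1 + ∑ b, lowv (fun i => 1) (C b) := by
        rw [Finset.sum_congr rfl (fun b _ => this b), Finset.sum_add_distrib]
        simp
      have h2 : ∑ x ∈ Finset.univ.filter (fun x : Fin L => ∃ a, C a = .low (some x)), 1 ≤ L := by
        rw [Finset.sum_const, smul_eq_mul, mul_one]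
        exact (Finset.card_le_univ _).trans (by simp)
      have h3 : L < 2 ^ L := Nat.lt_two_pow_self
      simp only [Finset.sum_const, smul_eq_mul, mul_one, Finset.card_univ, Fintype.card_fin] at h1
      omega
    obtain ⟨b, hb⟩ := hz
    have := X.stuck t (Finset.univ.filter (fun x : Fin L => ∃ a, C a = .low (some x)))
      (by
        intro i hi
        simp only [Finset.mem_filter, Finset.mem_univ, true_and] at hi
        obtain ⟨c, hc⟩ := hi
        exact hact _ _ _ _ ha hc) (hact _ _ _ _ ha hb)
    omega
  · have hsum : ∑ b, X.W (C b) = ∑ b, lowv (fun i => 2 ^ (i : ℕ)) (C b) := by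
      apply Finset.sum_congr rfl
      intro b _
      rcases hCb : C b with _ | (_ | i) | t'
      · exact absurd hCb (hC b)
      · simp [W, lowv, val]
      · simp [W, lowv, val]
      · exact absurd ⟨b, t', hCb⟩ hl
    omega

theorem reach_acc [Fintype T] {n : ℕ} (hn : d ≤ n) (C : Fin n → St L T)
    (hC : ∀ a, C a ≠ .acc) (hW : ∑ a, X.W (C a) = n) :
    ∃ D, X.prot.Reachable C D ∧ ∃ a, D a = .acc := by
  obtain ⟨B, hB⟩ : ∃ B, ∀ q, X.mu q ≤ B := by
    refine ⟨1 + ∑ t, 2 * X.m t, ?_⟩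
    rintro (_ | (_ | i) | t)
    · simp [mu]
    · simp [mu, zer]
    · simp [mu, zer]
    · have := Finset.single_le_sum (f := fun t => 2 * X.m t) (fun _ _ => Nat.zero_le _)
        (Finset.mem_univ t)
      simp only [mu]
      omega
  have hbd : ∀ F : Fin n → St L T, ∑ a, X.mu (F a) ≤ n * B := by
    intro F
    calc ∑ a, X.mu (F a) ≤ ∑ a : Fin n, B := Finset.sum_le_sum (fun a _ => hB _)
      _ = n * B := by simp
  induction hk : n * B - ∑ a, X.mu (C a) using Nat.strong_induction_on generalizing C with
  | _ k ih =>
    obtain ⟨D, hD, h | ⟨h1, h2, h3⟩⟩ := X.progress hn C hC hW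
    · exact ⟨D, Relation.ReflTransGen.single hD, h⟩
    · have := hbd D
      obtain ⟨E, hE, hE'⟩ := ih _ (by omega) D h1 h2 rfl
      exact ⟨E, Relation.ReflTransGen.head hD hE, hE'⟩

open Classical in
theorem spread {n : ℕ} (C : Fin n → St L T) (h : ∃ a, C a = .acc) :
    ∃ D, X.prot.Reachable C D ∧ ∀ a, D a = .acc := by
  induction hk : (Finset.univ.filter (fun a => C a ≠ .acc)).card using Nat.strong_induction_on
    generalizing C with
  | _ k ih =>
    by_cases hall : ∀ a, C a = .acc
    · exact ⟨C, Relation.ReflTransGen.refl, hall⟩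
    · push Not at hall
      obtain ⟨b, hb⟩ := hall
      obtain ⟨a, ha⟩ := h
      have hab : a ≠ b := by rintro rfl; exact hb ha
      obtain ⟨h1, h2, h3, h4⟩ := X.step_spec C a b hab
      rw [X.acc_del _ _ (Or.inl ha)] at h2 h3
      obtain ⟨E, hE, hE'⟩ := ih _ (by
        rw [← hk]
        apply Finset.card_lt_card
        rw [Finset.ssubset_iff_of_subset]
        · exact ⟨b, by simp [hb], by simp [h3]⟩
        · intro c hc
          simp only [Finset.mem_filter, Finset.mem_univ, true_and] at hc ⊢
          have hca : c ≠ a := by rintro rfl; exact hc h2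
          have hcb : c ≠ b := by rintro rfl; exact hc h3
          rwa [h4 c hca hcb] at hc) (X.step C a b) ⟨a, h2⟩ rfl
      exact ⟨E, Relation.ReflTransGen.head h1 hE, hE'⟩

instance [Fintype T] : Fintype (St L T) := Fintype.ofEquiv _ (St.equiv L T).symm

theorem card_St [Fintype T] : Fintype.card (St L T) = L + Fintype.card T + 2 := by
  rw [Fintype.card_congr (St.equiv L T)]
  simp; omega

theorem det : X.prot.Deterministic := fun a b => ⟨X.del a b, rfl⟩

theorem computes [Fintype T] : X.prot.Computes1Aware (threshold d) := by
  intro n _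
  refine ⟨?_, ?_⟩
  · intro hR C hC i
    simp only [threshold, decide_eq_false_iff_not, not_le] at hR
    exact (X.safe hR C hC).1 i
  · intro hR E hE hF
    simp only [threshold, decide_eq_true_eq] at hR
    have hreach : ∀ i, X.prot.Reachable (X.prot.initConfig n) (E i) := by
      intro i
      induction i with
      | zero => rw [hE.1]; exact Relation.ReflTransGen.refl
      | succ k ih => exact Relation.ReflTransGen.tail ih (hE.2 k)
    obtain ⟨C, hC⟩ := Finite.exists_infinite_fiber E
    have hinf : ∀ N : ℕ, ∃ i ≥ N, E i = C := by
      intro N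
      obtain ⟨i, hi, hNi⟩ := (Set.infinite_coe_iff.1 hC).exists_gt N
      exact ⟨i, hNi.le, hi⟩
    have hCr : X.prot.Reachable (X.prot.initConfig n) C := by
      obtain ⟨i, _, hi⟩ := hinf 0
      rw [← hi]; exact hreach i
    have h1 : ∃ D, X.prot.Reachable C D ∧ ∃ a, D a = .acc := by
      by_cases h : ∃ a, C a = .acc
      · exact ⟨C, Relation.ReflTransGen.refl, h⟩
      · have := (X.live_inv C hCr).resolve_left h
        push Not at h
        exact X.reach_acc hR C h this
    obtain ⟨D, hD, hD'⟩ := h1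
    obtain ⟨F, hF', hFa⟩ := X.spread D hD'
    obtain ⟨i0, _, hi0⟩ := hF C F hinf (Relation.ReflTransGen.trans hD hF') 0
    refine ⟨i0, ?_⟩
    intro i hi
    induction i, hi using Nat.le_induction with
    | base => intro a; rw [hi0]; exact hFa a
    | succ k _ ih =>
      intro a
      obtain ⟨x, y, hxy, hx, hy, hk⟩ := (X.trans_iff _ _).1 (hE.2 k)
      rw [X.acc_del _ _ (Or.inl (ih x))] at hx hy
      by_cases hax : a = x
      · rw [hax]; exact hx
      by_cases hay : a = y
      · rw [hay]; exact hy
      rw [hk a hax hay]; exact ih a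

end Data

theorem ones_double (m : ℕ) : onesCount (2 * m) = onesCount m := by
  rcases Nat.eq_zero_or_pos m with rfl | h
  · rfl
  · unfold onesCount
    rw [Nat.digits_def' (by norm_num) (by omega)]
    simp

theorem ones_double_add (m : ℕ) : onesCount (2 * m + 1) = onesCount m + 1 := by
  unfold onesCount
  rw [Nat.digits_def' (by norm_num) (by omega)]
  have h1 : (2 * m + 1) % 2 = 1 := by omega
  have h2 : (2 * m + 1) / 2 = m := by omega
  rw [h1, h2, List.count_cons]
  simp

theorem zeros_double (m : ℕ) (h : 0 < m) : zerosCount (2 * m) = zerosCount m + 1 := by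
  unfold zerosCount
  rw [Nat.digits_def' (by norm_num) (by omega)]
  simp

theorem zeros_double_add (m : ℕ) : zerosCount (2 * m + 1) = zerosCount m := by
  unfold zerosCount
  rw [Nat.digits_def' (by norm_num) (by omega)]
  have h1 : (2 * m + 1) % 2 = 1 := by omega
  have h2 : (2 * m + 1) / 2 = m := by omega
  rw [h1, h2, List.count_cons]
  simp

theorem log_double (m : ℕ) (h : 0 < m) : Nat.log 2 (2 * m) = Nat.log 2 m + 1 := by
  rw [mul_comm, Nat.log_mul_base (by norm_num) (by omega)]

theorem log_double_add (m : ℕ) (h : 0 < m) : Nat.log 2 (2 * m + 1) = Nat.log 2 m + 1 := by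
  rw [Nat.log_of_one_lt_of_le (by norm_num) (by omega)]
  congr 2
  omega

theorem bin_ind {p : ℕ → Prop} (h1 : p 1) (h2 : ∀ m, 0 < m → p m → p (2 * m))
    (h3 : ∀ m, 0 < m → p m → p (2 * m + 1)) : ∀ m, 0 < m → p m := by
  intro m
  induction m using Nat.strong_induction_on with
  | _ m ih =>
    intro hm
    by_cases h : m = 1
    · rwa [h]
    have e := ih (m / 2) (by omega) (by omega)
    rcases Nat.mod_two_eq_zero_or_one m with h0 | h0
    · have := h2 (m / 2) (by omega) e
      rwa [show 2 * (m / 2) = m by omega] at this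
    · have := h3 (m / 2) (by omega) e
      rwa [show 2 * (m / 2) + 1 = m by omega] at this

theorem setA : ∀ d, 0 < d → ∃ T : Finset ℕ, 2 ^ Nat.log 2 d ∈ T ∧ T.card ≤ onesCount d ∧ d ∈ T ∧
    ∀ p ∈ T, 2 ^ Nat.log 2 d ≤ p ∧ p ≤ d ∧ (p = d ∨ ∃ k, p + 2 ^ k ∈ T ∧ d < p + 2 ^ (k + 1)) := by
  apply bin_ind
  · refine ⟨{1}, by simp, by simp [onesCount], by simp, by simp⟩
  · rintro m hm ⟨T, h1, h2, h3, h4⟩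
    refine ⟨T.image (2 * ·), ?_, ?_, ?_, ?_⟩
    · rw [log_double m hm, pow_succ']; exact Finset.mem_image_of_mem _ h1
    · rw [ones_double]; exact Finset.card_image_le.trans h2
    · exact Finset.mem_image_of_mem _ h3
    · intro p hp
      obtain ⟨q, hq, rfl⟩ := Finset.mem_image.1 hp
      rw [log_double m hm, pow_succ]
      obtain ⟨a, b, c⟩ := h4 q hq
      refine ⟨by omega, by omega, ?_⟩
      rcases c with c | ⟨k, c1, c2⟩
      · left; omega
      · right
        refine ⟨k + 1, ?_, ?_⟩
        · have := Finset.mem_image_of_mem (2 * ·) c1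
          convert this using 1
          simp only [pow_succ]; ring
        · simp only [pow_succ] at c2 ⊢; omega
  · rintro m hm ⟨T, h1, h2, h3, h4⟩
    refine ⟨insert (2 * m + 1) (T.image (2 * ·)), ?_, ?_, ?_, ?_⟩
    · rw [log_double_add m hm, pow_succ']
      exact Finset.mem_insert_of_mem (Finset.mem_image_of_mem _ h1)
    · rw [ones_double_add]
      exact (Finset.card_insert_le _ _).trans (Nat.succ_le_succ (Finset.card_image_le.trans h2))
    · simp
    · intro p hp
      rw [log_double_add m hm, pow_succ]
      have hlm := Nat.pow_log_le_self 2 hm.ne'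
      rcases Finset.mem_insert.1 hp with rfl | hp
      · exact ⟨by omega, le_refl _, Or.inl rfl⟩
      obtain ⟨q, hq, rfl⟩ := Finset.mem_image.1 hp
      obtain ⟨a, b, c⟩ := h4 q hq
      refine ⟨by omega, by omega, Or.inr ?_⟩
      rcases c with c | ⟨k, c1, c2⟩
      · exact ⟨0, by simp [c], by simp [c]⟩
      · refine ⟨k + 1, ?_, ?_⟩
        · apply Finset.mem_insert_of_mem
          have := Finset.mem_image_of_mem (2 * ·) c1
          convert this using 1
          simp only [pow_succ]; ring
        · simp only [pow_succ] at c2 ⊢; omega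

theorem setB : ∀ m, 0 < m → ∃ (T : Finset ℕ) (t : ℕ), t + m + 1 = 2 ^ (Nat.log 2 m + 1) ∧
    0 ∈ T ∧ T.card ≤ zerosCount m + 1 ∧ t ∈ T ∧
    ∀ c ∈ T, c ≤ t ∧ (c = t ∨ ∃ b < Nat.log 2 m, c + 2 ^ b ∈ T) := by
  apply bin_ind
  · refine ⟨{0}, 0, by simp, by simp, by simp, by simp, by simp⟩
  · rintro m hm ⟨T, t, h0, h1, h2, h3, h4⟩
    refine ⟨insert (2 * t + 1) (T.image (2 * ·)), 2 * t + 1, ?_, ?_, ?_, ?_, ?_⟩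
    · rw [log_double m hm, pow_succ]; omega
    · exact Finset.mem_insert_of_mem (Finset.mem_image.2 ⟨0, h1, rfl⟩)
    · rw [zeros_double m hm]
      exact (Finset.card_insert_le _ _).trans (Nat.succ_le_succ (Finset.card_image_le.trans h2))
    · simp
    · intro p hp
      rw [log_double m hm]
      rcases Finset.mem_insert.1 hp with rfl | hp
      · exact ⟨le_refl _, Or.inl rfl⟩
      obtain ⟨q, hq, rfl⟩ := Finset.mem_image.1 hp
      obtain ⟨a, c⟩ := h4 q hq
      refine ⟨by omega, Or.inr ?_⟩
      rcases c with c | ⟨k, c1, c2⟩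
      · exact ⟨0, by omega, by simp [c]⟩
      · refine ⟨k + 1, by omega, ?_⟩
        apply Finset.mem_insert_of_mem
        have := Finset.mem_image_of_mem (2 * ·) c2
        convert this using 1
        simp only [pow_succ]; ring
  · rintro m hm ⟨T, t, h0, h1, h2, h3, h4⟩
    refine ⟨T.image (2 * ·), 2 * t, ?_, ?_, ?_, ?_, ?_⟩
    · rw [log_double_add m hm, pow_succ]; omega
    · exact Finset.mem_image.2 ⟨0, h1, rfl⟩
    · rw [zeros_double_add]
      exact Finset.card_image_le.trans h2
    · exact Finset.mem_image_of_mem _ h3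
    · intro p hp
      rw [log_double_add m hm]
      obtain ⟨q, hq, rfl⟩ := Finset.mem_image.1 hp
      obtain ⟨a, c⟩ := h4 q hq
      refine ⟨by omega, ?_⟩
      rcases c with c | ⟨k, c1, c2⟩
      · left; omega
      · right
        refine ⟨k + 1, by omega, ?_⟩
        have := Finset.mem_image_of_mem (2 * ·) c2
        convert this using 1
        simp only [pow_succ]; ring

open Classical in
theorem dataA (d : ℕ) (hd : 2 ^ Nat.log 2 d < d) :
    ∃ T : Finset ℕ, T.card ≤ onesCount d ∧ Nonempty (Data d (Nat.log 2 d) T) := by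
  obtain ⟨T, h1, h2, h3, h4⟩ := setA d (Nat.lt_of_le_of_lt (Nat.zero_le _) hd)
  have hlt : d < 2 ^ (Nat.log 2 d + 1) := Nat.lt_pow_succ_log_self (by norm_num) d
  refine ⟨T, h2, ⟨{
    w := fun t => t
    m := fun _ => 0
    t0 := ⟨_, h1⟩
    act := fun t s => if d ≤ t + val s then none else
      if h : s ≠ none ∧ (t : ℕ) + val s ∈ T then some (⟨_, h.2⟩, none) else some (t, s)
    hd := hd
    w0 := rfl
    wge := ?_
    wtwo := hlt.le
    act_none := ?_
    act_some := ?_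
    act_meas := ?_
    stuck := ?_ }⟩⟩
  · rintro ⟨t, ht⟩
    have := (h4 t ht).1
    rw [pow_succ] at hlt
    simp only; omega
  · intro t s h
    by_contra hc
    rw [if_neg hc] at h
    split at h <;> simp at h
  · intro t s t' s' h
    split at h
    · simp at h
    split at h
    · simp only [Option.some.injEq, Prod.mk.injEq] at h
      obtain ⟨rfl, rfl⟩ := h
      simp [val]
    · simp only [Option.some.injEq, Prod.mk.injEq] at h
      obtain ⟨rfl, rfl⟩ := h
      rfl
  · intro t s t' s' h hne
    split at h
    · simp at h
    split at h
    · next hh =>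
      simp only [Option.some.injEq, Prod.mk.injEq] at h
      obtain ⟨rfl, rfl⟩ := h
      rcases s with _ | i
      · simp at hh
      · simp [zer]
    · simp only [Option.some.injEq] at h
      exact absurd h.symm hne
  · rintro ⟨t, ht⟩ P hP h0
    obtain ⟨a, b, c⟩ := h4 t ht
    have htd : ¬ d ≤ t := by
      intro hc
      simp [val, hc] at h0
    obtain ⟨k, hk1, hk2⟩ := c.resolve_left (by omega)
    have hkd := (h4 _ hk1).2.1
    have : ∑ i ∈ P, 2 ^ (i : ℕ) < 2 ^ k := by
      apply Data.sum_pow_fin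
      intro i hi
      have := hP i hi
      by_contra hki
      split at this
      · simp at this
      · next hlt' =>
        simp only [val] at hlt'
        rcases Nat.lt_or_ge k i with hlt2 | hge
        · have : 2 ^ (k + 1) ≤ 2 ^ (i : ℕ) := Nat.pow_le_pow_right (by norm_num) hlt2
          omega
        · have hik : (i : ℕ) = k := by omega
          rw [dif_pos ⟨by simp, by simp only [val, hik]; exact hk1⟩] at this
          simp at this
    simp only
    omega

open Classical in
theorem dataB (m : ℕ) (hm : 0 < m) :
    ∃ T : Finset ℕ, T.card ≤ zerosCount m + 1 ∧ Nonempty (Data (m + 1) (Nat.log 2 m) T) := by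
  obtain ⟨T, t, h0, h1, h2, h3, h4⟩ := setB m hm
  have hle := Nat.pow_log_le_self 2 hm.ne'
  rw [pow_succ] at h0
  refine ⟨T, h2, ⟨{
    w := fun c => 2 ^ (Nat.log 2 m) - c
    m := fun c => c
    t0 := ⟨_, h1⟩
    act := fun c s => if h : s = none ∧ ∃ x : T × Fin (Nat.log 2 m), (x.1 : ℕ) = c + 2 ^ (x.2 : ℕ)
      then some (h.2.choose.1, some h.2.choose.2) else some (c, s)
    hd := by omega
    w0 := by simp
    wge := ?_
    wtwo := by rw [pow_succ]; omega
    act_none := ?_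
    act_some := ?_
    act_meas := ?_
    stuck := ?_ }⟩⟩
  · rintro ⟨c, hc⟩
    have := (h4 c hc).1
    simp only; omega
  · intro c s h
    split at h <;> simp at h
  · intro c s c' s' h
    split at h
    · next hh =>
      have hs := hh.2.choose_spec
      simp only [Option.some.injEq, Prod.mk.injEq] at h
      rw [h.1] at hs
      obtain ⟨-, rfl⟩ := h
      have := (h4 c' c'.2).1
      have hpos : 0 < 2 ^ (hh.2.choose.2 : ℕ) := by positivity
      have hv : val s = 0 := by rw [hh.1]; rfl
      rw [hv]
      simp only [val]
      omega
    · simp only [Option.some.injEq, Prod.mk.injEq] at h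
      obtain ⟨rfl, rfl⟩ := h
      rfl
  · intro c s c' s' h hne
    split at h
    · next hh =>
      have hs := hh.2.choose_spec
      simp only [Option.some.injEq, Prod.mk.injEq] at h
      rw [h.1] at hs
      obtain ⟨-, rfl⟩ := h
      have : 0 < 2 ^ (hh.2.choose.2 : ℕ) := by positivity
      have hv : zer s = 1 := by rw [hh.1]; rfl
      rw [hv]
      simp only [zer]
      omega
    · simp only [Option.some.injEq] at h
      exact absurd h.symm hne
  · rintro ⟨c, hc⟩ P hP h0'
    have hs := Data.sum_pow_fin P (Nat.log 2 m) (fun i _ => i.2)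
    obtain ⟨a, b⟩ := h4 c hc
    rcases b with b | ⟨k, hk, hk'⟩
    · simp only; omega
    · exfalso
      rw [dif_pos ⟨rfl, ⟨(⟨_, hk'⟩, ⟨k, hk⟩), rfl⟩⟩] at h0'
      simp at h0'

theorem finish {d L B : ℕ} (T : Finset ℕ) (X : Data d L T) (hB : L + T.card + 2 ≤ B) :
    ∃ (Q : Type) (inst : Fintype Q) (P : PopulationProtocol Q),
      P.Deterministic ∧ P.Computes1Aware (threshold d) ∧ @Fintype.card Q inst ≤ B := by
  refine ⟨St L T, inferInstance, X.prot, X.det, X.computes, ?_⟩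
  rw [Data.card_St]
  simpa using hB

def trivialP : PopulationProtocol Unit where
  Q0 := ∅
  Q1 := Set.univ
  qinit := ()
  delta := fun _ _ => {((), ())}
  union_eq := by simp
  inter_eq := by simp
  delta_nonempty := by simp

end UB

theorem upper_bound_min (d : ℕ) (hd : 0 < d) :
    ∃ (Q : Type) (inst : Fintype Q) (P : PopulationProtocol Q),
      P.Deterministic ∧ P.Computes1Aware (threshold d) ∧
      @Fintype.card Q inst ≤ Nat.log 2 d + min (onesCount d) (zerosCount (d - 1)) + 3 := by
  by_cases h1 : d = 1
  · subst h1
    refine ⟨Unit, inferInstance, UB.trivialP, fun _ _ => ⟨_, rfl⟩, ?_, by simp⟩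
    intro n hn
    refine ⟨?_, ?_⟩
    · intro h
      simp only [threshold, decide_eq_false_iff_not, not_le] at h
      omega
    · intro _ E _ _
      exact ⟨0, fun _ _ _ => Set.mem_univ _⟩
  obtain ⟨TB, hB, ⟨XB⟩⟩ := UB.dataB (d - 1) (by omega)
  rw [show d - 1 + 1 = d by omega] at XB
  have hlog : Nat.log 2 (d - 1) ≤ Nat.log 2 d := Nat.log_mono_right (by omega)
  by_cases hz : zerosCount (d - 1) ≤ onesCount d
  · rw [min_eq_right hz]
    exact UB.finish TB XB (by omega)
  · rw [min_eq_left (by omega)]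
    by_cases hp : 2 ^ Nat.log 2 d < d
    · obtain ⟨TA, hA, ⟨XA⟩⟩ := UB.dataA d hp
      exact UB.finish TA XA (by omega)
    · exfalso
      have hle := Nat.pow_log_le_self 2 hd.ne'
      have heq : d = 2 ^ Nat.log 2 d := by omega
      apply hz
      have : ∀ k, zerosCount (2 ^ k - 1) = 0 := by
        intro k
        induction k with
        | zero => rfl
        | succ k ih =>
          have : 0 < 2 ^ k := by positivity
          rw [show 2 ^ (k + 1) - 1 = 2 * (2 ^ k - 1) + 1 by rw [pow_succ]; omega,
            UB.zeros_double_add, ih]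
      rw [heq, this]
      exact Nat.zero_le _
end

section
/- For every positive integer d there exists a deterministic 1-aware population protocol computing the threshold predicate R_d with at most ⌊log₂ d⌋ + e(d) + 2 states. -/
namespace UB

def pre (d i : ℕ) : ℕ := d / 2 ^ i * 2 ^ i

def preS (d K : ℕ) : Finset ℕ := insert 0 ((Finset.range K).image (pre d))

def S (d : ℕ) : Finset ℕ :=
  preS d (Nat.log 2 d + 1) ∪ (Finset.range (Nat.log 2 d)).image (fun i => 2 ^ i)

lemma onesCount_step (m : ℕ) (hm : 0 < m) :
    onesCount m = onesCount (m / 2) + m % 2 := by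
  unfold onesCount
  rw [Nat.digits_def' (by norm_num) hm, List.count_cons]
  rcases Nat.mod_two_eq_zero_or_one m with h | h <;> simp [h]

lemma pre_succ (d i : ℕ) : pre d (i + 1) = 2 * pre (d / 2) i := by
  unfold pre
  rw [pow_succ', ← Nat.div_div_eq_div_mul]; ring

lemma card_preS (K d : ℕ) : (preS d (K + 1)).card ≤ onesCount d + 1 := by
  induction d using Nat.strong_induction_on with
  | _ d ih =>
    rcases Nat.eq_zero_or_pos d with rfl | hd
    · have : preS 0 (K + 1) ⊆ {0} := by
        intro x hx
        simp only [preS, Finset.mem_insert, Finset.mem_image] at hx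
        rcases hx with rfl | ⟨i, -, rfl⟩ <;> simp [pre]
      exact (Finset.card_le_card this).trans (by simp)
    · have h1 := ih (d / 2) (by omega)
      have h2 := onesCount_step d hd
      have h3 : ((preS (d / 2) (K + 1)).image (fun x => 2 * x)).card ≤ onesCount (d / 2) + 1 :=
        Finset.card_image_le.trans h1
      have hz : ∀ x ∈ preS d (K + 1), x = d ∨
          x ∈ (preS (d / 2) (K + 1)).image (fun x => 2 * x) := by
        intro x hx
        simp only [preS, Finset.mem_insert, Finset.mem_image, Finset.mem_range] at hx
        rcases hx with rfl | ⟨i, hi, rfl⟩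
        · right; simp [preS]
        · rcases i with _ | i
          · left; simp [pre]
          · right
            rw [pre_succ]
            refine Finset.mem_image_of_mem _ ?_
            exact Finset.mem_insert_of_mem
              (Finset.mem_image_of_mem _ (Finset.mem_range.2 (by omega)))
      rcases Nat.mod_two_eq_zero_or_one d with hm | hm
      · have : preS d (K + 1) ⊆ (preS (d / 2) (K + 1)).image (fun x => 2 * x) := by
          intro x hx
          rcases hz x hx with rfl | h
          · refine Finset.mem_image.2 ⟨x / 2, ?_, by omega⟩
            refine Finset.mem_insert_of_mem (Finset.mem_image.2 ⟨0, by simp, by simp [pre]⟩)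
          · exact h
        have := Finset.card_le_card this
        omega
      · have : preS d (K + 1) ⊆ insert d ((preS (d / 2) (K + 1)).image (fun x => 2 * x)) := by
          intro x hx
          rcases hz x hx with rfl | h
          · simp
          · exact Finset.mem_insert_of_mem h
        have := (Finset.card_le_card this).trans (Finset.card_insert_le _ _)
        omega

lemma card_S (d : ℕ) : (S d).card ≤ Nat.log 2 d + onesCount d + 2 := by
  have h1 := card_preS (Nat.log 2 d) d
  have h2 : ((Finset.range (Nat.log 2 d)).image (fun i => 2 ^ i)).card ≤ Nat.log 2 d :=
    Finset.card_image_le.trans (by simp)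
  have := Finset.card_union_le (preS d (Nat.log 2 d + 1))
    ((Finset.range (Nat.log 2 d)).image (fun i => 2 ^ i))
  unfold S
  omega

lemma zero_mem (d : ℕ) : 0 ∈ S d := by simp [S, preS]

lemma pre_mem (d i : ℕ) (hi : i ≤ Nat.log 2 d) : pre d i ∈ S d :=
  Finset.mem_union_left _ (Finset.mem_insert_of_mem
    (Finset.mem_image_of_mem _ (Finset.mem_range.2 (by omega))))

lemma self_mem (d : ℕ) : d ∈ S d := by
  simpa [pre] using pre_mem d 0 (by omega)

lemma pre_log (d : ℕ) (hd : 0 < d) : pre d (Nat.log 2 d) = 2 ^ Nat.log 2 d := by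
  have h1 := Nat.pow_log_le_self 2 hd.ne'
  have h2 := Nat.lt_pow_succ_log_self (b := 2) (by norm_num) d
  have : d / 2 ^ Nat.log 2 d = 1 := by
    rw [Nat.div_eq_iff (by positivity)]
    simp only [pow_succ] at h2; omega
  simp [pre, this]

lemma pow_mem (d i : ℕ) (hd : 0 < d) (hi : i ≤ Nat.log 2 d) : 2 ^ i ∈ S d := by
  rcases hi.lt_or_eq with h | rfl
  · exact Finset.mem_union_right _ (Finset.mem_image.2 ⟨i, by simpa using h, rfl⟩)
  · rw [← pre_log d hd]; exact pre_mem d _ le_rfl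

lemma one_mem (d : ℕ) (hd : 0 < d) : 1 ∈ S d := by
  simpa using pow_mem d 0 hd (by omega)

lemma mem_cases (d v : ℕ) (hd : 0 < d) (hv : v ∈ S d) (h0 : v ≠ 0) :
    (∃ i, i < Nat.log 2 d ∧ v = 2 ^ i) ∨
    (2 ^ Nat.log 2 d ≤ v ∧ ∃ i, i ≤ Nat.log 2 d ∧ v = pre d i) := by
  simp only [S, preS, Finset.mem_union, Finset.mem_insert, Finset.mem_image,
    Finset.mem_range] at hv
  rcases hv with (h | ⟨i, hi, rfl⟩) | ⟨i, hi, rfl⟩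
  · exact absurd h h0
  · right
    refine ⟨?_, i, by omega, rfl⟩
    obtain ⟨c, hc⟩ : ∃ c, Nat.log 2 d = c + i := ⟨Nat.log 2 d - i, by omega⟩
    unfold pre
    have h1 := Nat.pow_log_le_self 2 hd.ne'
    rw [hc, pow_add] at *
    exact Nat.mul_le_mul_right _ ((Nat.le_div_iff_mul_le (by positivity)).2 h1)
  · left; exact ⟨i, hi, rfl⟩

/-- distinct small powers have small sum -/
lemma sum_small {ι : Type*} (s : Finset ι) (v : ι → ℕ) (t : ℕ)
    (h : ∀ i ∈ s, v i ≠ 0 → ∃ j < t, v i = 2 ^ j)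
    (hinj : ∀ i ∈ s, ∀ j ∈ s, v i ≠ 0 → v i = v j → i = j) :
    ∑ i ∈ s, v i < 2 ^ t := by
  classical
  have h1 : ∑ i ∈ s, v i = ∑ i ∈ s with v i ≠ 0, v i := (Finset.sum_filter_ne_zero s).symm
  have h2 : ∑ x ∈ (s.filter (fun i => v i ≠ 0)).image v, x = ∑ i ∈ s with v i ≠ 0, v i := by
    refine Finset.sum_image ?_
    intro i hi j hj hij
    simp only [Finset.coe_filter, Set.mem_ofPred_eq] at hi hj
    exact hinj i hi.1 j hj.1 hi.2 hij
  have h3 : (s.filter (fun i => v i ≠ 0)).image v ⊆ (Finset.range t).image (fun i => 2 ^ i) := by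
    intro x hx
    obtain ⟨i, hi, rfl⟩ := Finset.mem_image.1 hx
    simp only [Finset.mem_filter] at hi
    obtain ⟨j, hj, hj'⟩ := h i hi.1 hi.2
    exact Finset.mem_image.2 ⟨j, by simpa using hj, hj'.symm⟩
  have h4 := Finset.sum_le_sum_of_subset (f := fun x : ℕ => x) h3
  have h5 : ∑ x ∈ (Finset.range t).image (fun i => 2 ^ i), x = ∑ i ∈ Finset.range t, 2 ^ i :=
    Finset.sum_image (fun i _ j _ hij => Nat.pow_right_injective le_rfl hij)
  have h6 : ∑ i ∈ Finset.range t, 2 ^ i < 2 ^ t := Nat.geomSum_lt le_rfl (by simp)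
  omega

lemma stuck {ι : Type*} [Fintype ι] (d : ℕ) (hd : 0 < d) (v : ι → ℕ)
    (hS : ∀ i, v i ∈ S d) (hlt : ∀ i, v i < d)
    (hp : ∀ i j, i ≠ j → v i ≠ 0 → v j ≠ 0 → v i + v j < d ∧ v i + v j ∉ S d) :
    ∑ i, v i < d := by
  classical
  have mc := fun v => mem_cases d v hd
  set k := Nat.log 2 d with hk
  have hk1 : 2 ^ k ≤ d := Nat.pow_log_le_self 2 hd.ne'
  have hk2 : d < 2 ^ k * 2 := Nat.lt_pow_succ_log_self (b := 2) (by norm_num) d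
  have hinj : ∀ i j, v i ≠ 0 → v i < 2 ^ k → v i = v j → i = j := by
    intro i j h0 hlt' heq
    by_contra hne
    have h := (hp i j hne h0 (heq ▸ h0)).2
    rcases mc _ (hS i) h0 with ⟨a, ha, hva⟩ | ⟨h', -⟩
    · apply h
      rw [← heq, hva, ← mul_two, ← pow_succ]
      exact pow_mem d _ hd ha
    · omega
  by_cases hbig : ∃ m, 2 ^ k ≤ v m
  · obtain ⟨m, hm⟩ := hbig
    have hkp : 0 < 2 ^ k := by positivity
    have hsm : ∀ i, i ≠ m → v i < 2 ^ k := by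
      intro i hi
      by_contra hc
      have := (hp i m hi (by omega) (by omega)).1
      omega
    have hex : ∃ i, v m = pre d i := by
      rcases mc _ (hS m) (by omega) with ⟨a, ha, hva⟩ | ⟨_, i, _, h⟩
      · have : 2 ^ a < 2 ^ k := Nat.pow_lt_pow_right (by norm_num) ha
        omega
      · exact ⟨i, h⟩
    have hfind := Nat.find_spec hex
    have hmin := fun j => Nat.find_min hex (m := j)
    generalize Nat.find hex = i at hfind hmin
    rcases i with _ | i
    · have := hlt m
      simp [pre] at hfind
      omega
    · have hne : v m ≠ pre d i := hmin i (by omega)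
      have hq : d / 2 ^ (i + 1) = d / 2 ^ i / 2 := by
        rw [pow_succ, Nat.div_div_eq_div_mul]
      have hmod : d / 2 ^ i % 2 = 1 := by
        rcases Nat.mod_two_eq_zero_or_one (d / 2 ^ i) with h | h
        · exfalso; apply hne
          rw [hfind]; unfold pre
          rw [hq, pow_succ']
          rw [← mul_assoc]
          congr 1; omega
        · exact h
      have hpre : pre d i = v m + 2 ^ i := by
        rw [hfind]; unfold pre
        rw [hq, pow_succ', ← mul_assoc, ← Nat.succ_mul]
        congr 1; omega
      have hdlt : d < v m + 2 ^ (i + 1) := by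
        rw [hfind]; unfold pre
        have := Nat.div_add_mod d (2 ^ (i + 1))
        have h2 := Nat.mod_lt d (y := 2 ^ (i + 1)) (by positivity)
        rw [mul_comm] at this
        omega
      have hle : v m + 2 ^ i ≤ d := by
        rw [← hpre]; exact Nat.div_mul_le_self _ _
      have hik : i ≤ k := by
        have : 2 ^ i ≤ d := by omega
        exact (Nat.le_log_iff_pow_le (by norm_num) hd.ne').2 this
      have hsum : ∑ j ∈ Finset.univ.erase m, v j < 2 ^ i := by
        apply sum_small
        · intro j hj hj0
          have hjm := (Finset.mem_erase.1 hj).1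
          have hj2 := hsm j hjm
          have h := hp m j (Ne.symm hjm) (by omega) hj0
          rcases mc _ (hS j) hj0 with ⟨a, ha, hva⟩ | ⟨h', _⟩
          · refine ⟨a, ?_, hva⟩
            by_contra hc
            rcases (not_lt.1 hc).eq_or_lt with rfl | hia
            · apply h.2
              rw [hva, ← hpre]; exact pre_mem d _ hik
            · have : 2 ^ (i + 1) ≤ 2 ^ a := Nat.pow_le_pow_right (by norm_num) hia
              omega
          · omega
        · intro a ha b hb h0 hab
          exact hinj a b h0 (hsm a (Finset.mem_erase.1 ha).1) hab
      rw [← Finset.add_sum_erase _ _ (Finset.mem_univ m)]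
      omega
  · push Not at hbig
    refine lt_of_lt_of_le (sum_small _ _ k ?_ ?_) hk1
    · intro i _ h0
      rcases mc _ (hS i) h0 with ⟨a, ha, hva⟩ | ⟨h', _⟩
      · exact ⟨a, ha, hva⟩
      · have := hbig i; omega
    · intro a _ b _ h0 hab
      exact hinj a b h0 (hbig a) hab

abbrev St_s1 (d : ℕ) : Type := {v : ℕ // v ∈ S d}

def acc (d : ℕ) : St_s1 d := ⟨d, self_mem d⟩

def step (d : ℕ) (a b : St_s1 d) : St_s1 d × St_s1 d :=
  if d ≤ a.1 + b.1 then (acc d, acc d)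
  else if h : a.1 + b.1 ∈ S d then (⟨a.1 + b.1, h⟩, ⟨0, zero_mem d⟩)
  else (a, b)

def prot (d : ℕ) (hd : 0 < d) : PopulationProtocol (St_s1 d) where
  Q0 := {q | q ≠ acc d}
  Q1 := {q | q = acc d}
  qinit := ⟨1, one_mem d hd⟩
  delta a b := {step d a b}
  union_eq := by ext q; simp; tauto
  inter_eq := by ext q; simp
  delta_nonempty _ _ := Set.singleton_nonempty _

variable {d : ℕ} (hd : 0 < d) {n : ℕ}

lemma trans_iff (C D : Fin n → St_s1 d) : (prot d hd).Transition C D ↔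
    ∃ i j : Fin n, i ≠ j ∧ D i = (step d (C i) (C j)).1 ∧ D j = (step d (C i) (C j)).2 ∧
    ∀ k : Fin n, k ≠ i → k ≠ j → D k = C k := by
  simp [PopulationProtocol.Transition, prot, Prod.ext_iff, and_assoc]

lemma mk_trans (C : Fin n → St_s1 d) (i j : Fin n) (hij : i ≠ j) :
    (prot d hd).Transition C
      (Function.update (Function.update C i (step d (C i) (C j)).1) j (step d (C i) (C j)).2) := by
  rw [trans_iff]
  refine ⟨i, j, hij, ?_, ?_, ?_⟩
  · rw [Function.update_of_ne hij, Function.update_self]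
  · rw [Function.update_self]
  · intro k hi hj
    rw [Function.update_of_ne hj, Function.update_of_ne hi]

lemma sum_split (f : Fin n → ℕ) (i j : Fin n) (hij : i ≠ j) :
    ∑ k, f k = f i + f j + ∑ k ∈ (Finset.univ.erase i).erase j, f k := by
  rw [← Finset.add_sum_erase _ f (Finset.mem_univ i),
    ← Finset.add_sum_erase _ f (Finset.mem_erase.2 ⟨hij.symm, Finset.mem_univ j⟩)]
  ring

lemma trans_sum (C D : Fin n → St_s1 d) (h : (prot d hd).Transition C D) :
    (d ≤ ∑ k, (C k).1 ∧ ∃ i, D i = acc d) ∨ ∑ k, (D k).1 = ∑ k, (C k).1 := by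
  rw [trans_iff] at h
  obtain ⟨i, j, hij, hi, hj, hk⟩ := h
  have e1 := sum_split (fun k => (C k).1) i j hij
  have e2 := sum_split (fun k => (D k).1) i j hij
  have e3 : ∑ k ∈ (Finset.univ.erase i).erase j, (D k).1 =
      ∑ k ∈ (Finset.univ.erase i).erase j, (C k).1 := by
    refine Finset.sum_congr rfl fun k hk' => ?_
    simp only [Finset.mem_erase, Finset.mem_univ, and_true] at hk'
    rw [hk k hk'.2 hk'.1]
  unfold step at hi hj
  split_ifs at hi hj with h1 h2
  · left; exact ⟨by omega, i, hi⟩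
  · right; rw [e1, e2, e3, hi, hj]; simp
  · right; rw [e1, e2, e3, hi, hj]

lemma trans_acc (C D : Fin n → St_s1 d) (h : (prot d hd).Transition C D) (m : Fin n)
    (hm : C m = acc d) : D m = acc d := by
  rw [trans_iff] at h
  obtain ⟨i, j, hij, hi, hj, hk⟩ := h
  by_cases h1 : m = i
  · subst h1
    rw [hi, step, if_pos]
    rw [hm]; simp [acc]
  · by_cases h2 : m = j
    · subst h2
      rw [hj, step, if_pos]
      rw [hm]; simp [acc]
    · rw [hk m h1 h2, hm]

def J (C : Fin n → St_s1 d) : Prop := ∑ k, (C k).1 = n ∨ ∃ i, C i = acc d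

lemma J_trans (C D : Fin n → St_s1 d) (h : (prot d hd).Transition C D) (hC : J C) : J D := by
  rcases hC with hC | ⟨i, hi⟩
  · rcases trans_sum hd C D h with ⟨_, h⟩ | h
    · exact Or.inr h
    · left; omega
  · exact Or.inr ⟨i, trans_acc hd C D h i hi⟩

lemma init_sum : ∑ k, ((prot d hd).initConfig n k).1 = n := by
  simp [PopulationProtocol.initConfig, prot]

lemma reach_small (hn : n < d) (C : Fin n → St_s1 d)
    (h : (prot d hd).Reachable ((prot d hd).initConfig n) C) : ∑ k, (C k).1 = n := by
  induction h with
  | refl => exact init_sum hd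
  | tail _ ht ih =>
    rcases trans_sum hd _ _ ht with ⟨h, _⟩ | h <;> omega

/-- Once there is an accepting agent, all agents can become accepting. -/
lemma reach_all (m : Fin n) (N : ℕ) : ∀ C : Fin n → St_s1 d, C m = acc d →
    (Finset.univ.filter (fun i => C i ≠ acc d)).card = N →
    (prot d hd).Reachable C (fun _ => acc d) := by
  induction N using Nat.strong_induction_on with
  | _ N ih =>
    intro C hm hN
    by_cases hall : ∀ i, C i = acc d
    · rw [show C = fun _ => acc d from funext hall]
      exact Relation.ReflTransGen.refl
    · push Not at hall
      obtain ⟨j, hj⟩ := hall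
      have hmj : m ≠ j := by rintro rfl; exact hj hm
      have ht := mk_trans hd C m j hmj
      have hs : step d (C m) (C j) = (acc d, acc d) := by
        rw [step, if_pos]; rw [hm]; simp [acc]
      refine Relation.ReflTransGen.head ht (ih _ ?_ _ (trans_acc hd _ _ ht m hm) rfl)
      rw [← hN]
      apply Finset.card_lt_card
      rw [Finset.ssubset_iff_of_subset]
      · refine ⟨j, by simpa using hj, ?_⟩
        simp [hs]
      · intro k
        simp only [Finset.mem_filter, Finset.mem_univ, true_and]
        intro h h'
        exact h (trans_acc hd _ _ ht k h')

lemma reach_acc (hn : d ≤ n) (N : ℕ) : ∀ C : Fin n → St_s1 d, J C →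
    (Finset.univ.filter (fun i => (C i).1 ≠ 0)).card = N →
    (prot d hd).Reachable C (fun _ => acc d) := by
  induction N using Nat.strong_induction_on with
  | _ N ih =>
    intro C hJ hN
    by_cases hex : ∃ i, C i = acc d
    · obtain ⟨m, hm⟩ := hex
      exact reach_all hd m _ C hm rfl
    have hsum : ∑ k, (C k).1 = n := hJ.resolve_right hex
    by_cases hbig : ∃ i j, i ≠ j ∧ d ≤ (C i).1 + (C j).1
    · obtain ⟨i, j, hij, hle⟩ := hbig
      have ht := mk_trans hd C i j hij
      refine Relation.ReflTransGen.head ht (reach_all hd j _ _ ?_ rfl)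
      rw [Function.update_self, step, if_pos hle]
    by_cases hmer : ∃ i j, i ≠ j ∧ (C i).1 ≠ 0 ∧ (C j).1 ≠ 0 ∧ (C i).1 + (C j).1 ∈ S d
    · obtain ⟨i, j, hij, hi, hj, hS⟩ := hmer
      have ht := mk_trans hd C i j hij
      have hs : (step d (C i) (C j)).2 = ⟨0, zero_mem d⟩ := by
        rw [step, if_neg (fun h => hbig ⟨i, j, hij, h⟩), dif_pos hS]
      refine Relation.ReflTransGen.head ht (ih _ ?_ _ (J_trans hd _ _ ht hJ) rfl)
      rw [← hN]
      apply Finset.card_lt_card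
      rw [Finset.ssubset_iff_of_subset]
      · refine ⟨j, by simpa using hj, ?_⟩
        simp [hs]
      · intro k
        simp only [Finset.mem_filter, Finset.mem_univ, true_and]
        intro h
        by_cases hkj : k = j
        · rw [hkj]; exact hj
        · rw [Function.update_of_ne hkj] at h
          by_cases hki : k = i
          · rw [hki]; exact hi
          · rwa [Function.update_of_ne hki] at h
    exfalso
    by_cases hge : ∃ i, d ≤ (C i).1
    · obtain ⟨i, hi⟩ := hge
      apply hex
      refine ⟨i, Subtype.ext ?_⟩
      by_contra hne
      have hne : (C i).1 ≠ d := hne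
      rcases mem_cases d _ hd (C i).2 (by omega) with ⟨a, ha, hva⟩ | ⟨_, a, _, hva⟩
      · have := Nat.pow_log_le_self 2 hd.ne'
        have : 2 ^ a < 2 ^ Nat.log 2 d := Nat.pow_lt_pow_right (by norm_num) ha
        omega
      · have : pre d a ≤ d := Nat.div_mul_le_self _ _
        omega
    · push Not at hge
      have := stuck d hd (fun i => (C i).1) (fun i => (C i).2) hge (by
        intro i j hij hi hj
        refine ⟨?_, fun h => hmer ⟨i, j, hij, hi, hj, h⟩⟩
        by_contra hc
        exact hbig ⟨i, j, hij, not_lt.1 hc⟩)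
      omega

lemma computes : (prot d hd).Computes1Aware (threshold d) := by
  intro n hn
  refine ⟨?_, ?_⟩
  · intro hR C hC i
    have hlt : n < d := by simpa [threshold] using hR
    have hs := reach_small hd hlt C hC
    have := Finset.single_le_sum (f := fun k => (C k).1) (fun _ _ => Nat.zero_le _)
      (Finset.mem_univ i)
    show C i ≠ acc d
    intro h
    simp only [h] at this
    simp only [acc] at this
    omega
  · intro hR E hE hF
    have hle : d ≤ n := by simpa [threshold] using hR
    have hJ : ∀ i, J (E i) := by
      intro i
      induction i with
      | zero => rw [hE.1]; exact Or.inl (init_sum hd)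
      | succ i ih => exact J_trans hd _ _ (hE.2 i) ih
    obtain ⟨C, hC⟩ := Finite.exists_infinite_fiber E
    have hC' : ∀ N : ℕ, ∃ i ≥ N, E i = C := by
      intro N
      have := (Set.infinite_coe_iff.1 hC).exists_gt N
      obtain ⟨b, hb, hb'⟩ := this
      exact ⟨b, hb'.le, hb⟩
    have hJC : J C := by
      obtain ⟨i, _, hi⟩ := hC' 0
      rw [← hi]; exact hJ i
    obtain ⟨i0, _, hi0⟩ := hF C _ hC' (reach_acc hd hle _ C hJC rfl) 0
    refine ⟨i0, fun i hi a => ?_⟩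
    show E i a = acc d
    induction i, hi using Nat.le_induction with
    | base => rw [hi0]
    | succ i _ ih => exact trans_acc hd _ _ (hE.2 i) a ih

end UB

theorem upper_bound_ones (d : ℕ) (hd : 0 < d) :
    ∃ (Q : Type) (inst : Fintype Q) (P : PopulationProtocol Q),
      P.Deterministic ∧ P.Computes1Aware (threshold d) ∧
      @Fintype.card Q inst ≤ Nat.log 2 d + onesCount d + 2 := by
  refine ⟨UB.St_s1 d, inferInstance, UB.prot d hd, ?_, UB.computes hd, ?_⟩
  · intro a b
    exact ⟨_, rfl⟩
  · rw [Fintype.card_coe]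
    exact UB.card_S d
end

section
/- For every positive integer d that is not a power of 2 (so that 2^k < d < 2^{k+1} where k = ⌊log₂ d⌋), there exists a deterministic 1-aware population protocol computing the threshold predicate R_d with at most ⌊log₂ d⌋ + z(d−1) + 2 states. -/
open Finset in
lemma sum_step {Q : Type} {n : ℕ} (f : Q → ℕ) (C1 C2 : Fin n → Q) (i j : Fin n) (hij : i ≠ j)
    (h : ∀ k : Fin n, k ≠ i → k ≠ j → C2 k = C1 k) :
    ∑ a, f (C2 a) + (f (C1 i) + f (C1 j)) = ∑ a, f (C1 a) + (f (C2 i) + f (C2 j)) := by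
  have key : ∀ C : Fin n → Q, ∑ a, f (C a) =
      f (C i) + (f (C j) + ∑ a ∈ (univ.erase i).erase j, f (C a)) := by
    intro C
    rw [add_sum_erase _ (fun a => f (C a)) (by simp [hij.symm] : j ∈ univ.erase i),
      add_sum_erase _ (fun a => f (C a)) (mem_univ i)]
  have h2 : ∑ a ∈ (univ.erase i).erase j, f (C2 a) = ∑ a ∈ (univ.erase i).erase j, f (C1 a) := by
    apply sum_congr rfl
    intro a ha
    simp only [mem_erase, mem_univ, and_true] at ha
    rw [h a ha.2 ha.1]
  rw [key C1, key C2, h2]; ring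

lemma three_le {n : ℕ} (f : Fin n → ℕ) (a b c : Fin n) (hab : a ≠ b) (hac : a ≠ c) (hbc : b ≠ c) :
    f a + f b + f c ≤ ∑ x, f x := by
  have : ∑ x ∈ ({a, b, c} : Finset (Fin n)), f x ≤ ∑ x, f x :=
    Finset.sum_le_sum_of_subset (Finset.subset_univ _)
  rw [Finset.sum_insert (by simp [hab, hac]), Finset.sum_insert (by simp [hbc]),
    Finset.sum_singleton] at this
  omega

/-- the protocol attached to a transition function and an accepting state -/
def mkP {Q : Type} (T init : Q) (g : Q → Q → Q × Q) : PopulationProtocol Q where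
  Q0 := {q | q ≠ T}
  Q1 := {T}
  qinit := init
  delta := fun a b => {g a b}
  union_eq := by ext q; simp [em]
  inter_eq := by ext q; simp
  delta_nonempty := fun a b => ⟨_, rfl⟩

lemma core {Q : Type} [Finite Q] (T X E init : Q) (w φ : Q → ℕ) (g : Q → Q → Q × Q) (d : ℕ)
    (hi1 : w init = 1) (hiT : init ≠ T) (hiX : init ≠ X) (hEX : E ≠ X)
    (hTl : ∀ q, g T q = (T, T)) (hTr : ∀ q, g q T = (T, T)) 
    (hS : ∀ q1 q2, q1 ≠ T → q2 ≠ T → ¬ (q1 = X ∧ q2 = X) →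
      w (g q1 q2).1 + w (g q1 q2).2 = w q1 + w q2 ∧ (g q1 q2).1 ≠ T ∧ (g q1 q2).2 ≠ T ∧
      ((((g q1 q2).1 = X → q1 = X) ∧ ((g q1 q2).2 = X → q2 = X)) ∨
        ((g q1 q2).1 = X ∧ (g q1 q2).2 = E)))
    (hXX : g X X = (T, T))
    (hd : d = 2 * w X + w E)
    (hφT : φ T = 0) (hφ : ∀ q, q ≠ T → 0 < φ q)
    (hprog : ∀ n (C : Fin n → Q), d ≤ n → (∀ a, C a ≠ T) → ∑ a, w (C a) = n →
      ∃ i j, i ≠ j ∧ φ (g (C i) (C j)).1 + φ (g (C i) (C j)).2 < φ (C i) + φ (C j)) :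
    (mkP T init g).Computes1Aware (threshold d) := by
  intro n hn
  constructor
  · intro hR C hC
    have hlt : n < d := by simpa [threshold] using hR
    have inv : (∀ a, C a ≠ T) ∧ ∑ a, w (C a) = n ∧ (∀ a b, C a = X → C b = X → a = b) := by
      induction hC with
      | refl =>
        refine ⟨fun a => hiT, ?_, fun a b h => absurd h hiX⟩
        simp [PopulationProtocol.initConfig, mkP, hi1]
      | @tail C1 C2 _ hst ih =>
        obtain ⟨h1, h2, h3⟩ := ih
        obtain ⟨i, j, hij, hg, hk⟩ := hst
        have hg : (C2 i, C2 j) = g (C1 i) (C1 j) := hg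
        have hs := hS (C1 i) (C1 j) (h1 i) (h1 j) (fun h => hij (h3 i j h.1 h.2))
        rw [← hg] at hs
        simp only at hs
        obtain ⟨hs1, hs2, hs3, hs4⟩ := hs
        have hsum := sum_step w C1 C2 i j hij hk
        have hsum2 : ∑ a, w (C2 a) = n := by omega
        have hT2 : ∀ a, C2 a ≠ T := by
          intro a
          by_cases hai : a = i
          · rw [hai]; exact hs2
          by_cases haj : a = j
          · rw [haj]; exact hs3
          rw [hk a hai haj]; exact h1 a
        refine ⟨hT2, hsum2, ?_⟩
        rcases hs4 with ⟨ha, hb⟩ | ⟨ha, hb⟩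
        · have hx : ∀ a, C2 a = X → C1 a = X := by
            intro a hx
            by_cases hai : a = i
            · subst hai; exact ha hx
            by_cases haj : a = j
            · subst haj; exact hb hx
            rw [← hk a hai haj]; exact hx
          intro a b hxa hxb
          exact h3 a b (hx a hxa) (hx b hxb)
        · intro a b hxa hxb
          by_contra hab
          have haj : a ≠ j := by rintro rfl; exact hEX (hb ▸ hxa)
          have hbj : b ≠ j := by rintro rfl; exact hEX (hb ▸ hxb)
          have := three_le (fun x => w (C2 x)) a b j hab haj hbj
          simp only [hxa, hxb, hb] at this
          omega
    exact inv.1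
  · intro hR E' hE hF
    have hle : d ≤ n := by simpa [threshold] using hR
    have invst : ∀ C : Fin n → Q, (mkP T init g).Reachable ((mkP T init g).initConfig n) C →
        (∃ a, C a = T) ∨ ∑ a, w (C a) = n := by
      intro C hC
      induction hC with
      | refl =>
        right
        simp [PopulationProtocol.initConfig, mkP, hi1]
      | @tail C1 C2 _ hst ih =>
        obtain ⟨i, j, hij, hg, hk⟩ := hst
        have hg : (C2 i, C2 j) = g (C1 i) (C1 j) := hg
        by_cases hTi : C1 i = T
        · rw [hTi, hTl] at hg
          exact Or.inl ⟨i, (Prod.ext_iff.1 hg).1⟩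
        by_cases hTj : C1 j = T
        · rw [hTj, hTr] at hg
          exact Or.inl ⟨i, (Prod.ext_iff.1 hg).1⟩
        by_cases hX2 : C1 i = X ∧ C1 j = X
        · rw [hX2.1, hX2.2, hXX] at hg
          exact Or.inl ⟨i, (Prod.ext_iff.1 hg).1⟩
        rcases ih with ⟨a, ha⟩ | ih
        · left
          refine ⟨a, ?_⟩
          rw [hk a (by rintro rfl; exact hTi ha) (by rintro rfl; exact hTj ha)]; exact ha
        · right
          have hs := (hS (C1 i) (C1 j) hTi hTj hX2).1
          rw [← hg] at hs
          simp only at hs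
          have hsum := sum_step w C1 C2 i j hij hk
          omega
    have prog : ∀ C : Fin n → Q, (mkP T init g).Reachable ((mkP T init g).initConfig n) C →
        C ≠ (fun _ => T) → ∃ i j, i ≠ j ∧
          φ (g (C i) (C j)).1 + φ (g (C i) (C j)).2 < φ (C i) + φ (C j) := by
      intro C hC hne
      by_cases hT : ∃ a, C a = T
      · obtain ⟨a, ha⟩ := hT
        obtain ⟨b, hb⟩ := Function.ne_iff.1 hne
        refine ⟨a, b, by rintro rfl; exact hb ha, ?_⟩
        rw [ha, hTl]
        have := hφ _ hb
        simp only [hφT]; omega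
      · rcases invst C hC with h | h
        · exact absurd h hT
        · exact hprog n C hle (fun a ha => hT ⟨a, ha⟩) h
    have reach : ∀ m : ℕ, ∀ C : Fin n → Q, ∑ a, φ (C a) = m →
        (mkP T init g).Reachable ((mkP T init g).initConfig n) C →
        (mkP T init g).Reachable C (fun _ => T) := by
      intro m
      induction m using Nat.strong_induction_on with
      | _ m ih =>
        intro C hm hC
        by_cases hne : C = (fun _ => T)
        · rw [hne]; exact Relation.ReflTransGen.refl
        obtain ⟨i, j, hij, hlt⟩ := prog C hC hne
        set C2 : Fin n → Q := Function.update (Function.update C i (g (C i) (C j)).1) j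
          (g (C i) (C j)).2 with hC2
        have e1 : C2 i = (g (C i) (C j)).1 := by simp [hC2, hij]
        have e2 : C2 j = (g (C i) (C j)).2 := by simp [hC2]
        have e3 : ∀ k : Fin n, k ≠ i → k ≠ j → C2 k = C k := by
          intro k h1 h2; simp [hC2, h1, h2]
        have ht : (mkP T init g).Transition C C2 := by
          refine ⟨i, j, hij, ?_, e3⟩
          rw [e1, e2]; exact rfl
        have hsum := sum_step φ C C2 i j hij e3
        rw [e1, e2] at hsum
        exact Relation.ReflTransGen.head ht
          (ih _ (by omega) C2 rfl (Relation.ReflTransGen.tail hC ht))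
    have hreachE : ∀ i, (mkP T init g).Reachable ((mkP T init g).initConfig n) (E' i) := by
      intro i
      induction i with
      | zero => rw [hE.1]; exact Relation.ReflTransGen.refl
      | succ i ih => exact Relation.ReflTransGen.tail ih (hE.2 i)
    obtain ⟨C, hCinf⟩ := Finite.exists_infinite_fiber E'
    have hinf : (E' ⁻¹' {C}).Infinite := Set.infinite_coe_iff.1 hCinf
    have hCN : ∀ N : ℕ, ∃ i ≥ N, E' i = C := by
      intro N
      obtain ⟨i, hi, hlt⟩ := hinf.exists_gt N
      exact ⟨i, hlt.le, hi⟩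
    obtain ⟨i1, -, hi1'⟩ := hCN 0
    have hCr : (mkP T init g).Reachable C (fun _ => T) := by
      rw [← hi1']; exact reach _ _ rfl (hreachE i1)
    obtain ⟨i0, -, hi0⟩ := hF C (fun _ => T) hCN hCr 0
    refine ⟨i0, ?_⟩
    intro i hi
    induction i, hi using Nat.le_induction with
    | base => intro a; rw [hi0]; exact rfl
    | succ i hi ih =>
      intro a
      obtain ⟨p, q, hpq, hg, hk⟩ := hE.2 i
      have hg : (E' (i+1) p, E' (i+1) q) = g (E' i p) (E' i q) := hg
      have hp : E' i p = T := ih p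
      rw [hp, hTl] at hg
      have := Prod.ext_iff.1 hg
      show E' (i+1) a = T
      by_cases hap : a = p
      · rw [hap]; exact this.1
      by_cases haq : a = q
      · rw [haq]; exact this.2
      rw [hk a hap haq]; exact ih a

lemma zc_even (m : ℕ) (hm : 0 < m) : zerosCount (2 * m) = zerosCount m + 1 := by
  unfold zerosCount
  rw [Nat.digits_def' (by norm_num) (by omega)]
  simp

lemma zc_odd (m : ℕ) : zerosCount (2 * m + 1) = zerosCount m := by
  unfold zerosCount
  rw [Nat.digits_def' (by norm_num) (by omega)]
  have h1 : (2 * m + 1) % 2 = 1 := by omega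
  have h2 : (2 * m + 1) / 2 = m := by omega
  rw [h1, h2]
  simp

/-- Decomposition of `D` by stripping bits. -/
lemma exW (k : ℕ) : ∀ D, 0 < D → D < 2 ^ k → ∃ W : Finset ℕ,
    W.card + 1 ≤ zerosCount (2 ^ (k + 1) - 1 - D) ∧
    (D ∈ W ∨ ∃ i < k, D = 2 ^ i) ∧
    ∀ v ∈ W, ∃ i < k, ∃ m, 0 < m ∧ v = 2 ^ i + m ∧ (m ∈ W ∨ ∃ j < k, m = 2 ^ j) := by
  induction k with
  | zero => intro D h1 h2; simp at h2; omega
  | succ k ih =>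
    intro D h1 h2
    have hp : 0 < 2 ^ k := by positivity
    have e1 : 2 ^ (k + 1) = 2 * 2 ^ k := by ring
    have e2 : 2 ^ (k + 1 + 1) = 2 * (2 * 2 ^ k) := by ring
    by_cases hD1 : D = 1
    · refine ⟨∅, ?_, Or.inr ⟨0, by omega, by simpa using hD1⟩, by simp⟩
      have : 2 ^ (k + 1 + 1) - 1 - D = 2 * (2 * 2 ^ k - 1) := by omega
      rw [this, zc_even _ (by omega)]; simp
    obtain ⟨W, hW1, hW2, hW3⟩ := ih (D / 2) (by omega) (by omega)
    have hc : (W.image (2 * ·)).card ≤ W.card := Finset.card_image_le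
    have hD2 : 2 * (D / 2) ∈ W.image (2 * ·) ∨ ∃ i < k + 1, 2 * (D / 2) = 2 ^ i := by
      rcases hW2 with h | ⟨i, hi, h⟩
      · exact Or.inl (Finset.mem_image_of_mem _ h)
      · exact Or.inr ⟨i + 1, by omega, by rw [h]; ring⟩
    have hW3' : ∀ v ∈ W.image (2 * ·), ∃ i < k + 1, ∃ m, 0 < m ∧ v = 2 ^ i + m ∧
        (m ∈ W.image (2 * ·) ∨ ∃ j < k + 1, m = 2 ^ j) := by
      intro v hv
      obtain ⟨u, hu, rfl⟩ := Finset.mem_image.1 hv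
      obtain ⟨i, hi, m, hm, rfl, h⟩ := hW3 u hu
      refine ⟨i + 1, by omega, 2 * m, by omega, by simp only [pow_succ]; ring, ?_⟩
      rcases h with h | ⟨j, hj, h⟩
      · exact Or.inl (Finset.mem_image_of_mem _ h)
      · exact Or.inr ⟨j + 1, by omega, by rw [h]; ring⟩
    rcases Nat.mod_two_eq_zero_or_one D with hm | hm
    · have hDe : 2 * (D / 2) = D := by omega
      refine ⟨W.image (2 * ·), ?_, by rw [hDe] at hD2; exact hD2, hW3'⟩
      have : 2 ^ (k + 1 + 1) - 1 - D = 2 * (2 ^ (k + 1) - 1 - D / 2) + 1 := by omega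
      rw [this, zc_odd]; omega
    · refine ⟨insert D (W.image (2 * ·)), ?_, Or.inl (Finset.mem_insert_self _ _), ?_⟩
      · have : 2 ^ (k + 1 + 1) - 1 - D = 2 * (2 ^ (k + 1) - 1 - D / 2) := by omega
        rw [this, zc_even _ (by omega)]
        have := Finset.card_insert_le D (W.image (2 * ·))
        omega
      · intro v hv
        rcases Finset.mem_insert.1 hv with rfl | hv
        · refine ⟨0, by omega, 2 * (v / 2), by omega, by simp; omega, ?_⟩
          rcases hD2 with h | h
          · exact Or.inl (Finset.mem_insert_of_mem h)
          · exact Or.inr h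
        · obtain ⟨i, hi, m, hm, h, h'⟩ := hW3' v hv
          refine ⟨i, hi, m, hm, h, ?_⟩
          rcases h' with h' | h'
          · exact Or.inl (Finset.mem_insert_of_mem h')
          · exact Or.inr h'

/-- weight -/
def wt (V : Finset ℕ) (x : ℕ) : Option (Option V) → ℕ
  | none => 0
  | some none => x
  | some (some v) => v.1

open Classical in
/-- potential of a value -/
noncomputable def psi (k v : ℕ) : ℕ := if ∃ i < k, v = 2 ^ i then 1 else 2 * v - 1

/-- potential -/
noncomputable def phi (V : Finset ℕ) (k M : ℕ) : Option (Option V) → ℕ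
  | none => 0
  | some none => 1
  | some (some v) => M + 1 + psi k v.1

lemma psi_pow (k i : ℕ) (hi : i < k) : psi k (2 ^ i) = 1 := if_pos ⟨i, hi, rfl⟩
lemma psi_zero (k : ℕ) : psi k 0 = 0 := by
  apply if_neg
  rintro ⟨i, _, hi⟩
  have : 0 < 2 ^ i := by positivity
  omega

lemma psi_le (k v : ℕ) : psi k v ≤ 2 * v - 1 := by
  unfold psi; split_ifs with h
  · obtain ⟨i, _, rfl⟩ := h
    have : 0 < 2 ^ i := by positivity
    omega
  · rfl

lemma exg (k D M : ℕ) (hD : 0 < D) (hDk : D < 2 ^ k) (hM : 2 * D ≤ M) (V : Finset ℕ) (h0 : 0 ∈ V)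
    (hp : ∀ i < k, 2 ^ i ∈ V) (hDV : D ∈ V)
    (hs : ∀ v ∈ V, v = 0 ∨ (∃ i < k, v = 2 ^ i) ∨ ∃ i < k, ∃ m ∈ V, 0 < m ∧ v = 2 ^ i + m)
    (q1 q2 : Option (Option V)) :
    ∃ r : Option (Option V) × Option (Option V),
      (q1 = none ∨ q2 = none → r = (none, none)) ∧
      (q1 = some none → q2 = some none → r = (none, none)) ∧
      (q1 ≠ none → q2 ≠ none → ¬ (q1 = some none ∧ q2 = some none) →
        wt V (2 ^ k - D) r.1 + wt V (2 ^ k - D) r.2 = wt V (2 ^ k - D) q1 + wt V (2 ^ k - D) q2 ∧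
        r.1 ≠ none ∧ r.2 ≠ none ∧
        (((r.1 = some none → q1 = some none) ∧ (r.2 = some none → q2 = some none)) ∨
        (r.1 = some none ∧ r.2 = some (some ⟨D, hDV⟩)))) ∧
      (∀ v : V, q1 = some (some v) → q2 = some (some v) → (∃ i < k, v.1 = 2 ^ i) →
        phi V k M r.1 + phi V k M r.2 < phi V k M q1 + phi V k M q2) ∧
      (∀ v : V, q1 = some (some v) → q2 = some (some ⟨0, h0⟩) → v.1 ≠ 0 → (¬ ∃ i < k, v.1 = 2 ^ i) →
        phi V k M r.1 + phi V k M r.2 < phi V k M q1 + phi V k M q2) := by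
  by_cases hT : q1 = none ∨ q2 = none
  · refine ⟨(none, none), fun _ => rfl, fun _ _ => rfl, ?_, ?_, ?_⟩
    · intro h1 h2; tauto
    · rintro v rfl rfl; simp at hT
    · rintro v rfl rfl; simp at hT
  by_cases hX : q1 = some none ∧ q2 = some none
  · refine ⟨(none, none), fun _ => rfl, fun _ _ => rfl, ?_, ?_, ?_⟩
    · intro h1 h2; tauto
    · rintro v rfl rfl; simp at hX
    · rintro v rfl rfl; simp at hX
  by_cases hpow : ∃ v : V, q1 = some (some v) ∧ q2 = some (some v) ∧ ∃ i < k, v.1 = 2 ^ i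
  · obtain ⟨⟨v, hv⟩, rfl, rfl, i, hi, hvi⟩ := hpow
    simp only at hvi
    subst hvi
    by_cases hik : i + 1 < k
    · refine ⟨(some (some ⟨2 ^ (i + 1), hp _ hik⟩), some (some ⟨0, h0⟩)), by simp, by simp, ?_, ?_, ?_⟩
      · intro _ _ _
        refine ⟨?_, by simp, by simp, Or.inl (by simp)⟩
        simp only [wt]; ring
      · intro v _ _ _
        simp only [phi, psi_pow k i hi, psi_pow k _ hik, psi_zero]; omega
      · intro v h1 h2 _ _
        simp only [phi, psi_pow k i hi, psi_pow k _ hik, psi_zero]; omega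
    · have hik : k = i + 1 := by omega
      have hpsi := psi_le k D
      refine ⟨(some none, some (some ⟨D, hDV⟩)), by simp, by simp, ?_, ?_, ?_⟩
      · intro _ _ _
        refine ⟨?_, by simp, by simp, Or.inr (by simp)⟩
        simp only [wt]
        have : 2 ^ k = 2 ^ i + 2 ^ i := by rw [hik]; ring
        omega
      · intro v _ _ _
        simp only [phi, psi_pow k i hi]; omega
      · intro v h1 h2 _ _
        simp only [phi, psi_pow k i hi]; omega
  by_cases hsp : ∃ v : V, q1 = some (some v) ∧ q2 = some (some ⟨0, h0⟩) ∧ v.1 ≠ 0 ∧ ¬ ∃ i < k, v.1 = 2 ^ i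
  · obtain ⟨⟨v, hv⟩, rfl, rfl, hv0, hvp⟩ := hsp
    simp only at hv0 hvp
    rcases hs v hv with h | h | ⟨i, hi, m, hm, hm0, hvm⟩
    · exact absurd h hv0
    · exact absurd h hvp
    have hpos : 0 < 2 ^ i := by positivity
    have hdec : phi V k M (some (some ⟨2 ^ i, hp i hi⟩)) + phi V k M (some (some ⟨m, hm⟩)) <
        phi V k M (some (some ⟨v, hv⟩)) + phi V k M (some (some ⟨0, h0⟩)) := by
      have h1 := psi_le k m
      have h2 : psi k v = 2 * v - 1 := by
        exact if_neg hvp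
      simp only [phi, psi_pow k i hi, psi_zero, h2]; omega
    refine ⟨(some (some ⟨2 ^ i, hp i hi⟩), some (some ⟨m, hm⟩)), by simp, by simp, ?_, ?_, ?_⟩
    · intro _ _ _
      refine ⟨?_, by simp, by simp, Or.inl (by simp)⟩
      simp only [wt]; omega
    · intro v' _ _ _; exact hdec
    · intro v' _ _ _ _; exact hdec
  · refine ⟨(q1, q2), by tauto, by tauto, ?_, ?_, ?_⟩
    · intro h1 h2 _
      exact ⟨rfl, h1, h2, Or.inl ⟨id, id⟩⟩
    · intro v h1 h2 h3; exact absurd ⟨v, h1, h2, h3⟩ hpow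
    · intro v h1 h2 h3 h4; exact absurd ⟨v, h1, h2, h3, h4⟩ hsp


open Finset in
lemma sum_bound (k D n : ℕ) (hk : 0 < k) (hDk : D < 2 ^ k) (V : Finset ℕ) (h0 : 0 ∈ V)
    (C : Fin n → Option (Option V)) (hT : ∀ a, C a ≠ none)
    (hsum : ∑ a, wt V (2 ^ k - D) (C a) = n)
    (hX : ∀ a b, a ≠ b → C a = some none → C b ≠ some none)
    (hv : ∀ a b, a ≠ b → ∀ v : V, C a = some (some v) → C b = some (some v) →
      ¬ ∃ i < k, v.1 = 2 ^ i)
    (hz : ∀ a b, a ≠ b → ∀ v : V, C a = some (some v) → C b = some (some ⟨0, h0⟩) →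
      v.1 ≠ 0 → ∃ i < k, v.1 = 2 ^ i) :
    n < 2 ^ (k + 1) - D := by
  have hpos : 0 < 2 ^ k := by positivity
  have hnp : ∀ a, ∀ v : V, C a = some (some v) → v.1 ≠ 0 → ∃ i < k, v.1 = 2 ^ i := by
    intro a v hav hv0
    by_contra hc
    have hv1 : v.1 ≠ 1 := fun h => hc ⟨0, hk, by simpa using h⟩
    have hex : ∃ b, wt V (2 ^ k - D) (C b) = 0 := by
      by_contra hne
      push Not at hne
      have : ∑ a : Fin n, 1 < ∑ a, wt V (2 ^ k - D) (C a) := by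
        apply sum_lt_sum
        · intro i _
          have := hne i
          omega
        · refine ⟨a, mem_univ _, ?_⟩
          rw [hav]; simp only [wt]; omega
      simp at this
      omega
    obtain ⟨b, hb⟩ := hex
    have hb0 : C b = some (some ⟨0, h0⟩) := by
      rcases hCb : C b with _ | _ | u
      · exact absurd hCb (hT b)
      · rw [hCb] at hb; simp only [wt] at hb; omega
      · rw [hCb] at hb; simp only [wt] at hb
        congr 2
        exact Subtype.ext hb
    have hab : a ≠ b := by
      rintro rfl
      rw [hav] at hb0
      simp only [Option.some.injEq] at hb0
      exact hv0 (by rw [hb0])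
    exact hc (hz a b hab v hav hb0 hv0)
  classical
  set A := univ.filter (fun a => C a = some none) with hA
  have hAc : A.card ≤ 1 := by
    rw [card_le_one]
    intro a ha b hb
    by_contra hab
    exact hX a b hab (by simpa [hA] using ha) (by simpa [hA] using hb)
  have hsA : ∑ a ∈ A, wt V (2 ^ k - D) (C a) ≤ 2 ^ k - D := by
    have : ∑ a ∈ A, wt V (2 ^ k - D) (C a) = ∑ a ∈ A, (2 ^ k - D) := by
      apply sum_congr rfl
      intro a ha
      have : C a = some none := by simpa [hA] using ha
      rw [this]; rfl
    rw [this, sum_const, smul_eq_mul]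
    nlinarith
  set B := univ.filter (fun a => ¬ C a = some none) with hB
  have hsB : ∑ a ∈ B, wt V (2 ^ k - D) (C a) ≤ 2 ^ k - 1 := by
    set B' := B.filter (fun a => wt V (2 ^ k - D) (C a) ≠ 0) with hB'
    have e1 : ∑ a ∈ B', wt V (2 ^ k - D) (C a) = ∑ a ∈ B, wt V (2 ^ k - D) (C a) :=
      sum_filter_ne_zero B
    have hBv : ∀ a ∈ B', ∃ v : V, C a = some (some v) ∧ ∃ i < k, v.1 = 2 ^ i := by
      intro a ha
      rw [hB', mem_filter, hB, mem_filter] at ha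
      obtain ⟨⟨_, h1⟩, h2⟩ := ha
      rcases hCa : C a with _ | _ | u
      · exact absurd hCa (hT a)
      · exact absurd hCa h1
      · rw [hCa] at h2
        exact ⟨u, rfl, hnp a u hCa h2⟩
    have hinj : Set.InjOn (fun a => wt V (2 ^ k - D) (C a)) B' := by
      intro a ha b hb hab
      by_contra hne
      obtain ⟨v, hv1, hv2⟩ := hBv a ha
      obtain ⟨u, hu1, hu2⟩ := hBv b hb
      simp only [hv1, hu1, wt] at hab
      have : v = u := Subtype.ext hab
      subst this
      exact hv a b hne v hv1 hu1 hv2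
    rw [← e1, ← sum_image (f := fun x => x) hinj]
    calc ∑ x ∈ B'.image (fun a => wt V (2 ^ k - D) (C a)), x
        ≤ ∑ x ∈ (range k).image (fun i => 2 ^ i), x := by
          apply sum_le_sum_of_subset
          intro x hx
          obtain ⟨a, ha, rfl⟩ := mem_image.1 hx
          obtain ⟨v, hv1, i, hi, hvi⟩ := hBv a ha
          rw [mem_image]
          refine ⟨i, mem_range.2 hi, ?_⟩
          simp only [hv1, wt, hvi]
      _ = ∑ i ∈ range k, 2 ^ i := by
          rw [sum_image]
          intro a _ b _ h
          exact Nat.pow_right_injective (le_refl 2) h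
      _ ≤ 2 ^ k - 1 := by
          have := Nat.geomSum_eq (le_refl 2) k
          rw [this]; simp
  have htot : ∑ a ∈ A, wt V (2 ^ k - D) (C a) + ∑ a ∈ B, wt V (2 ^ k - D) (C a) = n := by
    refine Eq.trans ?_ hsum
    exact sum_filter_add_sum_filter_not _ _ _
  have : 2 ^ (k + 1) = 2 * 2 ^ k := by ring
  omega

theorem upper_bound_zeros (d : ℕ) (hd : 0 < d) (hnp : ¬ ∃ k : ℕ, d = 2 ^ k) :
    ∃ (Q : Type) (inst : Fintype Q) (P : PopulationProtocol Q),
      P.Deterministic ∧ P.Computes1Aware (threshold d) ∧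
      @Fintype.card Q inst ≤ Nat.log 2 d + zerosCount (d - 1) + 2 := by
  set k := Nat.log 2 d with hk
  have h1 : 2 ^ k ≤ d := Nat.pow_log_le_self 2 (by omega)
  have h2 : d < 2 ^ (k + 1) := Nat.lt_pow_succ_log_self (by norm_num) d
  have h3 : d ≠ 2 ^ k := fun h => hnp ⟨k, h⟩
  have e : 2 ^ (k + 1) = 2 * 2 ^ k := by ring
  obtain ⟨D, hD⟩ : ∃ D, D = 2 ^ (k + 1) - d := ⟨_, rfl⟩
  have hD0 : 0 < D := by omega
  have hDk : D < 2 ^ k := by omega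
  have hk0 : 0 < k := by
    rcases Nat.eq_zero_or_pos k with h | h
    · rw [h] at hDk; simp at hDk; omega
    · exact h
  obtain ⟨W, hW1, hW2, hW3⟩ := exW k D hD0 hDk
  have hd1 : 2 ^ (k + 1) - 1 - D = d - 1 := by omega
  rw [hd1] at hW1
  set V : Finset ℕ := insert 0 (W ∪ (Finset.range k).image (fun i => 2 ^ i)) with hV
  have h0 : 0 ∈ V := Finset.mem_insert_self _ _
  have hp : ∀ i < k, 2 ^ i ∈ V := fun i hi => by
    rw [hV, Finset.mem_insert, Finset.mem_union, Finset.mem_image]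
    exact Or.inr (Or.inr ⟨i, Finset.mem_range.2 hi, rfl⟩)
  have hWV : ∀ m, (m ∈ W ∨ ∃ j < k, m = 2 ^ j) → m ∈ V := by
    rintro m (h | ⟨j, hj, rfl⟩)
    · rw [hV, Finset.mem_insert, Finset.mem_union]; exact Or.inr (Or.inl h)
    · exact hp j hj
  have hDV : D ∈ V := hWV D hW2
  have hs : ∀ v ∈ V, v = 0 ∨ (∃ i < k, v = 2 ^ i) ∨
      ∃ i < k, ∃ m ∈ V, 0 < m ∧ v = 2 ^ i + m := by
    intro v hv
    rw [hV, Finset.mem_insert, Finset.mem_union, Finset.mem_image] at hv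
    rcases hv with h | h | ⟨i, hi, h⟩
    · exact Or.inl h
    · obtain ⟨i, hi, m, hm, hvm, hmW⟩ := hW3 v h
      exact Or.inr (Or.inr ⟨i, hi, m, hWV m hmW, hm, hvm⟩)
    · exact Or.inr (Or.inl ⟨i, Finset.mem_range.1 hi, h.symm⟩)
  have hcard : V.card ≤ k + W.card + 1 := by
    have a1 := Finset.card_insert_le 0 (W ∪ (Finset.range k).image (fun i => 2 ^ i))
    have a2 := Finset.card_union_le W ((Finset.range k).image (fun i => 2 ^ i))
    have a3 : ((Finset.range k).image (fun i => 2 ^ i)).card ≤ (Finset.range k).card :=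
      Finset.card_image_le
    rw [Finset.card_range] at a3
    rw [hV]
    omega
  choose g hg1 hg2 hg3 hg4 hg5 using
    exg k D (2 * D) hD0 hDk le_rfl V h0 hp hDV hs
  have h1V : 1 ∈ V := by simpa using hp 0 hk0
  refine ⟨Option (Option V), inferInstance, mkP none (some (some ⟨1, h1V⟩)) g, ?_, ?_, ?_⟩
  · intro q1 q2
    exact ⟨g q1 q2, rfl⟩
  · refine core none (some none) (some (some ⟨D, hDV⟩)) _ (wt V (2 ^ k - D))
      (phi V k (2 * D)) g d rfl (by simp) (by simp) (by simp)
      (fun q => hg1 _ _ (Or.inl rfl)) (fun q => hg1 _ _ (Or.inr rfl)) hg3 (hg2 _ _ rfl rfl)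
      (by simp only [wt]; omega) rfl ?_ ?_
    · intro q hq
      rcases q with _ | _ | v
      · exact absurd rfl hq
      · simp [phi]
      · simp [phi]
    · intro n C hn hT hsum
      by_contra hc
      push Not at hc
      have := sum_bound k D n hk0 hDk V h0 C hT hsum ?_ ?_ ?_
      · omega
      · intro a b hab ha hb
        have h := hc a b hab
        rw [hg2 _ _ ha hb, ha, hb] at h
        simp [phi] at h
      · intro a b hab v ha hb hv
        exact absurd (hg4 _ _ v ha hb hv) (by have := hc a b hab; omega)
      · intro a b hab v ha hb hv0
        by_contra hv
        exact absurd (hg5 _ _ v ha hb hv0 hv) (by have := hc a b hab; omega)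
  · simp only [Fintype.card_option, Fintype.card_coe]
    omega
end

section
/- For every positive integer d, every 1-aware population protocol ⟨Q, Q₀, Q₁, q_init, δ⟩ computing the threshold predicate R_d has at least log₂ d + 1 states, i.e., 2^{|Q| − 1} ≥ d. -/
section FairWalk

/-- `c` reaches `t` in exactly `n` steps. -/
def StepsTo {X : Type} (r : X → X → Prop) (t : X) : ℕ → X → Prop
  | 0, c => c = t
  | n + 1, c => ∃ c', r c c' ∧ StepsTo r t n c'

theorem exists_stepsTo {X : Type} {r : X → X → Prop} {c t : X}
    (h : Relation.ReflTransGen r c t) : ∃ n, StepsTo r t n c := by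
  induction h using Relation.ReflTransGen.head_induction_on with
  | refl => exact ⟨0, rfl⟩
  | head h1 _ ih => obtain ⟨n, hn⟩ := ih; exact ⟨n + 1, _, h1, hn⟩

theorem StepsTo.reach {X : Type} {r : X → X → Prop} {t : X} :
    ∀ {n : ℕ} {c : X}, StepsTo r t n c → Relation.ReflTransGen r c t
  | 0, c, h => by cases h; exact .refl
  | n + 1, c, ⟨c', h1, h2⟩ => .head h1 (StepsTo.reach h2)

theorem exists_bottom {X : Type} [Finite X] (r : X → X → Prop) (x : X) :
    ∃ b, Relation.ReflTransGen r x b ∧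
      ∀ c, Relation.ReflTransGen r b c → Relation.ReflTransGen r c b := by
  classical
  obtain ⟨b, hb, hmin⟩ := Set.exists_min_image {b | Relation.ReflTransGen r x b}
    (fun b => {c | Relation.ReflTransGen r b c}.ncard) (Set.toFinite _) ⟨x, .refl⟩
  refine ⟨b, hb, fun c hc => ?_⟩
  have h1 := hmin c (hb.trans hc)
  have hsub : {d | Relation.ReflTransGen r c d} ⊆ {d | Relation.ReflTransGen r b d} :=
    fun d hd => hc.trans hd
  have := Set.eq_of_subset_of_ncard_le hsub h1 (Set.toFinite _)
  have hm : b ∈ {d | Relation.ReflTransGen r b d} := .refl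
  rw [← this] at hm
  exact hm

theorem exists_fair_walk {X : Type} [Finite X] (r : X → X → Prop)
    (hser : ∀ x, ∃ y, r x y) (x : X) :
    ∃ E : ℕ → X, E 0 = x ∧ (∀ i, r (E i) (E (i + 1))) ∧
      ∀ C D, (∀ N : ℕ, ∃ i ≥ N, E i = C) → Relation.ReflTransGen r C D →
        ∀ N : ℕ, ∃ i ≥ N, E i = D := by
  classical
  obtain ⟨b, hxb, hb⟩ := exists_bottom r x
  let T := {c // Relation.ReflTransGen r b c}
  have : Nonempty T := ⟨⟨b, .refl⟩⟩
  obtain ⟨e, he⟩ := exists_surjective_nat T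
  -- a sequence which visits every element of `T` at arbitrarily large indices
  let u : ℕ → T := fun k => e (Nat.unpair k).1
  have hu : ∀ t : T, ∀ N : ℕ, ∃ k ≥ N, u k = t := by
    intro t N
    obtain ⟨a, ha⟩ := he t
    exact ⟨Nat.pair a N, Nat.right_le_pair a N, by simp [u, ha]⟩
  let S := {c // Relation.ReflTransGen r c b}
  have hreach : ∀ (c : S) (t : T), ∃ n, StepsTo r t.1 n c.1 :=
    fun c t => exists_stepsTo (c.2.trans t.2)
  let dist : S → T → ℕ := fun c t => Nat.find (hreach c t)
  have hstep : ∀ s : S × ℕ, ∃ s' : S × ℕ, r s.1.1 s'.1.1 ∧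
      ((s.1.1 = (u s.2).1 ∧ s'.2 = s.2 + 1) ∨
        (s'.2 = s.2 ∧ dist s'.1 (u s.2) < dist s.1 (u s.2))) := by
    rintro ⟨c, k⟩
    by_cases hc : c.1 = (u k).1
    · obtain ⟨y, hy⟩ := hser c.1
      have : Relation.ReflTransGen r b c.1 := hc ▸ (u k).2
      exact ⟨(⟨y, hb _ (this.tail hy)⟩, k + 1), hy, Or.inl ⟨hc, rfl⟩⟩
    · have hs : StepsTo r (u k).1 (dist c (u k)) c.1 := Nat.find_spec (hreach c (u k))
      cases hd : dist c (u k) with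
      | zero => rw [hd] at hs; exact absurd hs hc
      | succ n =>
        rw [hd] at hs
        obtain ⟨c', h1, h2⟩ := hs
        refine ⟨(⟨c', h2.reach.trans (hb _ (u k).2)⟩, k), h1, Or.inr ⟨rfl, ?_⟩⟩
        exact Nat.lt_succ_of_le (Nat.find_min' _ h2)
  choose nx hnx1 hnx2 using hstep
  let s : ℕ → S × ℕ := fun i => Nat.rec (⟨x, hxb⟩, 0) (fun _ p => nx p) i
  have hs : ∀ i, s (i + 1) = nx (s i) := fun _ => rfl
  have hE : ∀ i, r (s i).1.1 (s (i + 1)).1.1 := fun i => by rw [hs]; exact hnx1 _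
  have hit : ∀ n i, dist (s i).1 (u (s i).2) = n →
      ∃ j ≥ i, (s j).2 = (s i).2 ∧ (s j).1.1 = (u (s i).2).1 := by
    intro n
    induction n using Nat.strong_induction_on with
    | _ n ih =>
      intro i hi
      rcases hnx2 (s i) with h | ⟨h1, h2⟩
      · exact ⟨i, le_rfl, rfl, h.1⟩
      · rw [← hs] at h1 h2
        obtain ⟨j, hj, h3, h4⟩ := ih _ (by rw [h1]; exact hi ▸ h2) (i + 1) rfl
        exact ⟨j, by omega, by rw [h3, h1], by rw [h4, h1]⟩
  have hle : ∀ i, (s i).2 ≤ i := by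
    intro i
    induction i with
    | zero => exact le_rfl
    | succ i ih =>
      rcases hnx2 (s i) with h | h
      · rw [hs, h.2]; omega
      · rw [hs, h.1]; omega
  have hall : ∀ k, ∃ i, (s i).2 = k ∧ (s i).1.1 = (u k).1 := by
    intro k
    have h0 : ∃ i, (s i).2 = k := by
      induction k with
      | zero => exact ⟨0, rfl⟩
      | succ k ih =>
        by_contra hcon
        obtain ⟨i, hi⟩ := ih
        -- the index never changes, while the distance keeps decreasing
        have hst : ∀ j, (s (i + j)).2 = k ∧
            dist (s (i + j)).1 (u k) + j ≤ dist (s i).1 (u k) := by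
          intro j
          induction j with
          | zero => exact ⟨hi, le_rfl⟩
          | succ j ihj =>
            rcases hnx2 (s (i + j)) with h | ⟨h1, h2⟩
            · exact absurd ⟨i + j + 1, by rw [hs, h.2, ihj.1]⟩ hcon
            · rw [← hs, ihj.1] at h1 h2
              refine ⟨h1, ?_⟩
              have := ihj.2
              rw [show i + (j + 1) = i + j + 1 from rfl]
              omega
        have := (hst (dist (s i).1 (u k) + 1)).2
        omega
    obtain ⟨i, hi⟩ := h0
    obtain ⟨j, _, h1, h2⟩ := hit _ i rfl
    exact ⟨j, by rw [h1, hi], by rw [h2, hi]⟩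
  have hinf : ∀ t : T, ∀ N, ∃ i ≥ N, (s i).1.1 = t.1 := by
    intro t N
    obtain ⟨k, hk, hkt⟩ := hu t N
    obtain ⟨i, h1, h2⟩ := hall k
    exact ⟨i, by have := hle i; omega, by rw [h2, hkt]⟩
  refine ⟨fun i => (s i).1.1, rfl, hE, ?_⟩
  intro C D hC hCD
  obtain ⟨i0, _, hi0⟩ := hinf ⟨b, .refl⟩ 0
  have hin : ∀ j, Relation.ReflTransGen r b (s (i0 + j)).1.1 := by
    intro j
    induction j with
    | zero => rw [add_zero, hi0]
    | succ j ih => exact ih.tail (hE _)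
  obtain ⟨i, hi, hiC⟩ := hC i0
  obtain ⟨j, rfl⟩ := Nat.exists_eq_add_of_le hi
  have hbC : Relation.ReflTransGen r b C := hiC ▸ hin j
  exact hinf ⟨D, hbC.trans hCD⟩

end FairWalk

namespace PopulationProtocol

variable {Q : Type} (P : PopulationProtocol Q)

theorem transition_exists {n : ℕ} (hn : 2 ≤ n) (C : Fin n → Q) :
    ∃ D, P.Transition C D := by
  let i : Fin n := ⟨0, by omega⟩
  let j : Fin n := ⟨1, by omega⟩
  have hij : i ≠ j := by simp [i, j]
  obtain ⟨⟨a, b⟩, hab⟩ := P.delta_nonempty (C i) (C j)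
  refine ⟨Function.update (Function.update C i a) j b, i, j, hij, ?_, ?_⟩
  · simpa [Function.update_of_ne hij] using hab
  · intro k h1 h2
    rw [Function.update_of_ne h2, Function.update_of_ne h1]

theorem reach_append_left {m n : ℕ} {C D : Fin m → Q} (E : Fin n → Q)
    (h : P.Reachable C D) : P.Reachable (Fin.append C E) (Fin.append D E) := by
  refine Relation.ReflTransGen.lift (fun C => Fin.append C E) ?_ _ _ h
  rintro A B ⟨i, j, hij, h1, h2⟩
  refine ⟨Fin.castAdd n i, Fin.castAdd n j, ?_, by simpa using h1, ?_⟩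
  · simpa [Fin.ext_iff] using hij
  · intro k
    refine Fin.addCases (fun k hi hj => ?_) (fun k _ _ => ?_) k
    · simp only [Fin.append_left]
      exact h2 k (fun h => hi (by rw [h])) (fun h => hj (by rw [h]))
    · simp

theorem reach_append_right {m n : ℕ} {C D : Fin n → Q} (E : Fin m → Q)
    (h : P.Reachable C D) : P.Reachable (Fin.append E C) (Fin.append E D) := by
  refine Relation.ReflTransGen.lift (fun C => Fin.append E C) ?_ _ _ h
  rintro A B ⟨i, j, hij, h1, h2⟩
  refine ⟨Fin.natAdd m i, Fin.natAdd m j, ?_, by simpa using h1, ?_⟩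
  · simpa [Fin.ext_iff] using hij
  · intro k
    refine Fin.addCases (fun k _ _ => ?_) (fun k hi hj => ?_) k
    · simp
    · simp only [Fin.append_right]
      exact h2 k (fun h => hi (by rw [h])) (fun h => hj (by rw [h]))

theorem init_append (m n : ℕ) :
    P.initConfig (m + n) = Fin.append (P.initConfig m) (P.initConfig n) := by
  funext k
  refine Fin.addCases (fun k => ?_) (fun k => ?_) k <;> simp [initConfig]

/-- states that can occur from `I_n` -/
def occ (n : ℕ) : Set Q := {q | P.CanOccur (P.initConfig n) q}

theorem occ_mono (m n : ℕ) : P.occ m ⊆ P.occ (m + n) := by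
  rintro q ⟨D, hD, i, hi⟩
  refine ⟨Fin.append D (P.initConfig n), ?_, Fin.castAdd n i, by simpa using hi⟩
  rw [init_append]
  exact P.reach_append_left _ hD

theorem occ_delta {m n : ℕ} {p q a b : Q} (hp : p ∈ P.occ m) (hq : q ∈ P.occ n)
    (hab : (a, b) ∈ P.delta p q) : a ∈ P.occ (m + n) ∧ b ∈ P.occ (m + n) := by
  obtain ⟨D, hD, i, rfl⟩ := hp
  obtain ⟨E, hE, j, rfl⟩ := hq
  have h : P.Reachable (P.initConfig (m + n)) (Fin.append D E) := by
    rw [init_append]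
    exact (P.reach_append_left _ hD).trans (P.reach_append_right _ hE)
  have hij : Fin.castAdd n i ≠ Fin.natAdd m j := by
    intro h
    have := congrArg Fin.val h
    simp at this
    omega
  let F := Function.update (Function.update (Fin.append D E) (Fin.castAdd n i) a)
    (Fin.natAdd m j) b
  have hFi : F (Fin.castAdd n i) = a := by simp [F, Function.update_of_ne hij]
  have hFj : F (Fin.natAdd m j) = b := by simp [F]
  have hF : P.Reachable (P.initConfig (m + n)) F := by
    refine h.tail ⟨Fin.castAdd n i, Fin.natAdd m j, hij, ?_, ?_⟩
    · rw [hFi, hFj]; simpa using hab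
    · intro k h1 h2
      simp only [F]
      rw [Function.update_of_ne h2, Function.update_of_ne h1]
  exact ⟨⟨F, hF, _, hFi⟩, ⟨F, hF, _, hFj⟩⟩

/-- closure under interactions -/
def ClosedSet (T : Set Q) : Prop :=
  ∀ p ∈ T, ∀ q ∈ T, ∀ a b, (a, b) ∈ P.delta p q → a ∈ T ∧ b ∈ T

theorem closed_reach {T : Set Q} (hT : P.ClosedSet T) (h0 : P.qinit ∈ T) {n : ℕ}
    {C : Fin n → Q} (h : P.Reachable (P.initConfig n) C) : ∀ i, C i ∈ T := by
  induction h with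
  | refl => exact fun _ => h0
  | tail _ h2 ih =>
    obtain ⟨i, j, _, h3, h4⟩ := h2
    have := hT _ (ih i) _ (ih j) _ _ h3
    intro k
    by_cases hi : k = i
    · exact hi ▸ this.1
    by_cases hj : k = j
    · exact hj ▸ this.2
    rw [h4 k hi hj]
    exact ih k

theorem qinit_occ {n : ℕ} (hn : 0 < n) : P.qinit ∈ P.occ n :=
  ⟨_, .refl, ⟨0, hn⟩, rfl⟩

theorem occ_pow [Finite Q] (k : ℕ) :
    k + 1 ≤ (P.occ (2 ^ k)).ncard ∨ P.ClosedSet (P.occ (2 ^ k)) := by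
  induction k with
  | zero =>
    left
    have : (P.occ (2 ^ 0)).Nonempty := ⟨_, P.qinit_occ (by simp)⟩
    exact (Set.ncard_pos (Set.toFinite _)).2 this
  | succ k ih =>
    have e : 2 ^ (k + 1) = 2 ^ k + 2 ^ k := by ring
    have hsub : P.occ (2 ^ k) ⊆ P.occ (2 ^ (k + 1)) := by rw [e]; exact P.occ_mono _ _
    by_cases heq : P.occ (2 ^ k) = P.occ (2 ^ (k + 1))
    · right
      rw [← heq]
      intro p hp q hq a b hab
      rw [heq, e]
      exact P.occ_delta hp hq hab
    · rcases ih with ih | ih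
      · left
        have := Set.ncard_lt_ncard (hsub.ssubset_of_ne heq) (Set.toFinite _)
        omega
      · exfalso
        apply heq
        refine hsub.antisymm ?_
        rintro q ⟨D, hD, i, rfl⟩
        exact P.closed_reach ih (P.qinit_occ (by positivity)) hD i

end PopulationProtocol

theorem lower_bound (d : ℕ) (hd : 0 < d) (Q : Type) [Fintype Q]
    (P : PopulationProtocol Q) (h : P.Computes1Aware (threshold d)) :
    d ≤ 2 ^ (Fintype.card Q - 1) := by
  by_contra hlt
  push Not at hlt
  have hpos : 0 < 2 ^ (Fintype.card Q - 1) := by positivity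
  have hcl : P.ClosedSet (P.occ (2 ^ (Fintype.card Q - 1))) := by
    rcases P.occ_pow (Fintype.card Q - 1) with h1 | h1
    · have : P.occ (2 ^ (Fintype.card Q - 1)) = Set.univ := by
        apply Set.eq_of_subset_of_ncard_le (Set.subset_univ _) _ (Set.toFinite _)
        rw [Set.ncard_univ, Nat.card_eq_fintype_card]
        omega
      rw [this]
      intro p _ q _ a b _
      exact ⟨trivial, trivial⟩
    · exact h1
  have hQ0 : ∀ q ∈ P.occ (2 ^ (Fintype.card Q - 1)), q ∈ P.Q0 := by
    rintro q ⟨D, hD, i, rfl⟩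
    exact (h _ hpos).1 (by simp [threshold, hlt]) D hD i
  obtain ⟨E, hE0, hE1, hE2⟩ := exists_fair_walk (P.Transition (n := d))
    (P.transition_exists (by omega)) (P.initConfig d)
  obtain ⟨i0, hi0⟩ := (h d hd).2 (by simp [threshold]) E ⟨hE0, hE1⟩ hE2
  have hr : ∀ i, P.Reachable (P.initConfig d) (E i) := by
    intro i
    induction i with
    | zero => rw [hE0]; exact .refl
    | succ i ih => exact ih.tail (hE1 i)
  have h1 := hi0 i0 le_rfl ⟨0, hd⟩
  have h0 := hQ0 _ (P.closed_reach hcl (P.qinit_occ hpos) (hr i0) ⟨0, hd⟩)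
  have : E i0 ⟨0, hd⟩ ∈ P.Q0 ∩ P.Q1 := ⟨h0, h1⟩
  rw [P.inter_eq] at this
  exact this
end

section
/- Let Π be any population protocol. If a < b are two consecutive elements of f(Q) (i.e., a, b ∈ f(Q), a < b, and no element of f(Q) lies strictly between a and b), then b ≤ 2a. -/
namespace PopulationProtocol

variable {Q : Type} (P : PopulationProtocol Q)

theorem reach_extend {m n : ℕ} (e : Fin m → Fin n) (he : Function.Injective e)
    (C : Fin n → Q) (X D : Fin m → Q) (h : P.Reachable X D) :
    P.Reachable (Function.extend e X C) (Function.extend e D C) := by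
  induction h with
  | refl => exact Relation.ReflTransGen.refl
  | tail _ h2 ih =>
    refine Relation.ReflTransGen.tail ih ?_
    obtain ⟨i, j, hij, hd, hk⟩ := h2
    refine ⟨e i, e j, he.ne hij, ?_, ?_⟩
    · simpa only [he.extend_apply] using hd
    · intro k hki hkj
      by_cases hk' : ∃ l, e l = k
      · obtain ⟨l, rfl⟩ := hk'
        simp only [he.extend_apply]
        exact hk l (fun h => hki (by rw [h])) (fun h => hkj (by rw [h]))
      · rw [Function.extend_apply' _ _ _ hk', Function.extend_apply' _ _ _ hk']

theorem extend_self {m n : ℕ} (e : Fin m → Fin n) (he : Function.Injective e)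
    (C : Fin n → Q) (X : Fin m → Q) (h : ∀ l, C (e l) = X l) :
    Function.extend e X C = C := by
  funext k
  by_cases hk' : ∃ l, e l = k
  · obtain ⟨l, rfl⟩ := hk'
    rw [he.extend_apply, h]
  · rw [Function.extend_apply' _ _ _ hk']

theorem occ_pair {n1 n2 : ℕ} {q1 q2 r1 r2 : Q}
    (h1 : P.CanOccur (P.initConfig n1) q1) (h2 : P.CanOccur (P.initConfig n2) q2)
    (hd : (r1, r2) ∈ P.delta q1 q2) :
    P.CanOccur (P.initConfig (n1 + n2)) r1 ∧ P.CanOccur (P.initConfig (n1 + n2)) r2 := by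
  obtain ⟨D1, hD1, i, rfl⟩ := h1
  obtain ⟨D2, hD2, j, rfl⟩ := h2
  have he1 : Function.Injective (Fin.castAdd n2 : Fin n1 → Fin (n1 + n2)) :=
    Fin.castAdd_injective n1 n2
  have he2 : Function.Injective (Fin.natAdd n1 : Fin n2 → Fin (n1 + n2)) :=
    Fin.natAdd_injective n2 n1
  have hne : ∀ (x : Fin n1) (y : Fin n2), Fin.castAdd n2 x ≠ Fin.natAdd n1 y := by
    intro x y h
    have := congrArg Fin.val h
    simp at this
    omega
  have s1 := P.reach_extend _ he1 (P.initConfig (n1 + n2)) _ _ hD1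
  rw [extend_self _ he1 (P.initConfig (n1 + n2)) (P.initConfig n1) (fun _ => rfl)] at s1
  set C1 := Function.extend (Fin.castAdd n2 : Fin n1 → Fin (n1 + n2)) D1
    (P.initConfig (n1 + n2)) with hC1
  have s2 := P.reach_extend _ he2 C1 _ _ hD2
  rw [extend_self _ he2 C1 (P.initConfig n2) (fun l => by
    rw [hC1, Function.extend_apply' _ _ _ (fun ⟨x, hx⟩ => hne x l hx)]; rfl)] at s2
  set C2 := Function.extend (Fin.natAdd n1 : Fin n2 → Fin (n1 + n2)) D2 C1 with hC2
  have e1 : C2 (Fin.castAdd n2 i) = D1 i := by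
    rw [hC2, Function.extend_apply' _ _ _ (fun ⟨x, hx⟩ => hne i x hx.symm), hC1,
      he1.extend_apply]
  have e2 : C2 (Fin.natAdd n1 j) = D2 j := by rw [hC2, he2.extend_apply]
  let C3 := Function.update (Function.update C2 (Fin.castAdd n2 i) r1) (Fin.natAdd n1 j) r2
  have f1 : C3 (Fin.castAdd n2 i) = r1 := by
    simp only [C3]
    rw [Function.update_of_ne (hne i j), Function.update_self]
  have f2 : C3 (Fin.natAdd n1 j) = r2 := Function.update_self ..
  have ht : P.Transition C2 C3 := by
    refine ⟨_, _, hne i j, ?_, ?_⟩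
    · rw [f1, f2, e1, e2]; exact hd
    · intro k h1 h2
      simp only [C3]
      rw [Function.update_of_ne h2, Function.update_of_ne h1]
  have hr : P.Reachable (P.initConfig (n1 + n2)) C3 :=
    Relation.ReflTransGen.tail (Relation.ReflTransGen.trans s1 s2) ht
  exact ⟨⟨C3, hr, _, f1⟩, ⟨C3, hr, _, f2⟩⟩

theorem f_le {n : ℕ} {q : Q} (hn : 0 < n) (h : P.CanOccur (P.initConfig n) q) :
    P.f q ≤ n := sInf_le ⟨n, rfl, hn, h⟩

theorem of_f_eq {n : ℕ} {q : Q} (h : P.f q = n) :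
    0 < n ∧ P.CanOccur (P.initConfig n) q := by
  have hne : {m : ℕ∞ | ∃ n : ℕ, m = (n : ℕ∞) ∧ 0 < n ∧
      P.CanOccur (P.initConfig n) q}.Nonempty := by
    by_contra hh
    rw [Set.not_nonempty_iff_eq_empty] at hh
    rw [f, hh, sInf_empty] at h
    exact ENat.top_ne_coe n h
  obtain ⟨k, hk, h0, hc⟩ := csInf_mem hne
  have : (n : ℕ∞) = k := h.symm.trans hk
  obtain rfl : n = k := by exact_mod_cast this
  exact ⟨h0, hc⟩

end PopulationProtocol

theorem no_large_gaps (Q : Type) [Fintype Q] (P : PopulationProtocol Q)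
    (a b : ℕ) (ha : a ∈ P.fQ) (hb : b ∈ P.fQ) (hab : a < b)
    (hcons : ∀ c ∈ P.fQ, ¬(a < c ∧ c < b)) :
    b ≤ 2 * a := by
  by_contra hlt
  push Not at hlt
  obtain ⟨qa, hqa⟩ := ha
  have ha0 := (P.of_f_eq hqa).1
  have small : ∀ n q, 0 < n → n ≤ 2 * a → P.CanOccur (P.initConfig n) q →
      ∃ m, 0 < m ∧ m ≤ a ∧ P.CanOccur (P.initConfig m) q := by
    intro n q hn hna h
    have hle := P.f_le hn h
    obtain ⟨c, hc⟩ := ENat.ne_top_iff_exists.mp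
      (ne_top_of_le_ne_top (ENat.coe_ne_top n) hle)
    rw [← hc] at hle
    have hle' : c ≤ n := by exact_mod_cast hle
    obtain ⟨h0, ho⟩ := P.of_f_eq hc.symm
    have := hcons c ⟨q, hc.symm⟩
    exact ⟨c, h0, by omega, ho⟩
  have key : ∀ (n : ℕ) (D : Fin n → Q), P.Reachable (P.initConfig n) D → ∀ k,
      ∃ m, 0 < m ∧ m ≤ a ∧ P.CanOccur (P.initConfig m) (D k) := by
    intro n D h
    induction h with
    | refl => exact fun k => ⟨1, one_pos, ha0, P.initConfig 1, Relation.ReflTransGen.refl, 0, rfl⟩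
    | tail _ h2 ih =>
      obtain ⟨i, j, hij, hd, hk⟩ := h2
      obtain ⟨m1, p1, l1, o1⟩ := ih i
      obtain ⟨m2, p2, l2, o2⟩ := ih j
      have hp := P.occ_pair o1 o2 hd
      intro k
      by_cases hki : k = i
      · subst hki
        exact small (m1 + m2) _ (by omega) (by omega) hp.1
      by_cases hkj : k = j
      · subst hkj
        exact small (m1 + m2) _ (by omega) (by omega) hp.2
      rw [hk k hki hkj]
      exact ih k
  obtain ⟨q, hq⟩ := hb
  obtain ⟨_, D, hD, i, rfl⟩ := P.of_f_eq hq
  obtain ⟨m, hm, hma, ho⟩ := key b D hD i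
  have := P.f_le hm ho
  rw [hq] at this
  have : b ≤ m := by exact_mod_cast this
  omega
end

section
/- Let Π be any population protocol, q₁, q₂ ∈ Q, and n₁, n₂ ∈ ℤ⁺. If q₁ can occur from I_{n₁} and q₂ can occur from I_{n₂}, then there is a configuration D reachable from I_{n₁+n₂} and two distinct agents i ≠ j in [n₁+n₂] with D(i) = q₁ and D(j) = q₂. -/
theorem reach_left_aux {Q : Type} (P : PopulationProtocol Q) {m n : ℕ} (E : Fin n → Q)
    {C D : Fin m → Q} (h : P.Reachable C D) :
    P.Reachable (Fin.append C E) (Fin.append D E) := by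
  refine Relation.ReflTransGen.lift (fun C => Fin.append C E) ?_ _ _ h
  rintro A B ⟨i, j, hij, hd, hk⟩
  refine ⟨Fin.castAdd n i, Fin.castAdd n j, ?_, by simpa using hd, ?_⟩
  · intro h
    exact hij (Fin.castAdd_injective m n h)
  · intro k
    refine Fin.addCases (fun k h1 h2 => ?_) (fun k h1 h2 => ?_) k
    · have := hk k (fun e => h1 (by rw [e])) (fun e => h2 (by rw [e]))
      simpa using this
    · simp

theorem reach_right_aux {Q : Type} (P : PopulationProtocol Q) {m n : ℕ} (E : Fin m → Q)
    {C D : Fin n → Q} (h : P.Reachable C D) :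
    P.Reachable (Fin.append E C) (Fin.append E D) := by
  refine Relation.ReflTransGen.lift (fun C => Fin.append E C) ?_ _ _ h
  rintro A B ⟨i, j, hij, hd, hk⟩
  refine ⟨Fin.natAdd m i, Fin.natAdd m j, ?_, by simpa using hd, ?_⟩
  · intro h
    exact hij (Fin.natAdd_injective n m h)
  · intro k
    refine Fin.addCases (fun k h1 h2 => ?_) (fun k h1 h2 => ?_) k
    · simp
    · have := hk k (fun e => h1 (by rw [e])) (fun e => h2 (by rw [e]))
      simpa using this

theorem combine_occurrences (Q : Type) [Fintype Q] (P : PopulationProtocol Q)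
    (q1 q2 : Q) (n1 n2 : ℕ) (h1 : 0 < n1) (h2 : 0 < n2)
    (ho1 : P.CanOccur (P.initConfig n1) q1)
    (ho2 : P.CanOccur (P.initConfig n2) q2) :
    ∃ D : Fin (n1 + n2) → Q, P.Reachable (P.initConfig (n1 + n2)) D ∧
      ∃ i j : Fin (n1 + n2), i ≠ j ∧ D i = q1 ∧ D j = q2 := by
  obtain ⟨D1, r1, i, hi⟩ := ho1
  obtain ⟨D2, r2, j, hj⟩ := ho2
  have e : P.initConfig (n1 + n2) = Fin.append (P.initConfig n1) (P.initConfig n2) := by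
    funext k
    refine Fin.addCases (fun k => ?_) (fun k => ?_) k <;>
      simp [PopulationProtocol.initConfig]
  refine ⟨Fin.append D1 D2, ?_, Fin.castAdd n2 i, Fin.natAdd n1 j, ?_, by simpa using hi,
    by simpa using hj⟩
  · rw [e]
    exact Relation.ReflTransGen.trans (reach_left_aux P _ r1) (reach_right_aux P _ r2)
  · intro h
    have := congrArg Fin.val h
    simp at this
    omega
end

section
/- Let Π = ⟨Q, Q₀, Q₁, q_init, δ⟩ be a population protocol, d ∈ ℤ⁺, and let q_f ∈ Q₁ be a state such that δ(q_f, q) = δ(q, q_f) = {(q_f, q_f)} for every q ∈ Q. Suppose: (soundness) for every n < d, every configuration C reachable from I_n satisfies C([n]) ⊆ Q₀; and (completeness) for every n ≥ d, every configuration reachable from I_n can reach a configuration that has at least one agent in state q_f. Then Π is a 1-aware population protocol computing the threshold predicate R_d. -/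
theorem trans_keep_qf {Q : Type} (P : PopulationProtocol Q) (qf : Q)
    (hdelta : ∀ q : Q, P.delta qf q = {(qf, qf)} ∧ P.delta q qf = {(qf, qf)})
    {n : ℕ} {C D : Fin n → Q} (h : P.Transition C D) (a : Fin n) (ha : C a = qf) :
    D a = qf := by
  obtain ⟨i, j, hij, hm, hk⟩ := h
  by_cases h1 : a = i
  · subst h1
    rw [ha, (hdelta _).1] at hm
    exact (Prod.mk.inj hm).1
  by_cases h2 : a = j
  · subst h2
    rw [ha, (hdelta _).2] at hm
    exact (Prod.mk.inj hm).2
  rw [hk a h1 h2, ha]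

theorem reach_all_qf {Q : Type} (P : PopulationProtocol Q) (qf : Q)
    (hdelta : ∀ q : Q, P.delta qf q = {(qf, qf)} ∧ P.delta q qf = {(qf, qf)})
    {n : ℕ} (C : Fin n → Q) (a : Fin n) (ha : C a = qf) (s : Finset (Fin n)) :
    ∃ D : Fin n → Q, P.Reachable C D ∧ D a = qf ∧ ∀ b ∈ s, D b = qf := by
  induction s using Finset.induction_on with
  | empty => exact ⟨C, Relation.ReflTransGen.refl, ha, by simp⟩
  | insert b s hb ih =>
    obtain ⟨D, hr, hDa, hs⟩ := ih
    by_cases hab : a = b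
    · subst hab
      refine ⟨D, hr, hDa, fun c hc => ?_⟩
      rcases Finset.mem_insert.1 hc with rfl | hc
      · exact hDa
      · exact hs c hc
    · have ht : P.Transition D (Function.update D b qf) := by
        refine ⟨a, b, hab, ?_, fun k _ hk => Function.update_of_ne hk _ _⟩
        rw [hDa, (hdelta _).1, Function.update_self, Function.update_of_ne hab, hDa]
        rfl
      refine ⟨_, Relation.ReflTransGen.tail hr ht, trans_keep_qf P qf hdelta ht a hDa,
        fun c hc => ?_⟩
      rcases Finset.mem_insert.1 hc with rfl | hc
      · exact Function.update_self _ _ _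
      · exact trans_keep_qf P qf hdelta ht c (hs c hc)

theorem computes_of_sound_complete (Q : Type) [Fintype Q]
    (P : PopulationProtocol Q) (d : ℕ) (hd : 0 < d)
    (qf : Q) (hqf : qf ∈ P.Q1)
    (hdelta : ∀ q : Q, P.delta qf q = {(qf, qf)} ∧ P.delta q qf = {(qf, qf)})
    (sound : ∀ n : ℕ, 0 < n → n < d →
      ∀ C : Fin n → Q, P.Reachable (P.initConfig n) C → ∀ i : Fin n, C i ∈ P.Q0)
    (complete : ∀ n : ℕ, d ≤ n →
      ∀ C : Fin n → Q, P.Reachable (P.initConfig n) C →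
        ∃ D : Fin n → Q, P.Reachable C D ∧ ∃ i : Fin n, D i = qf) :
    P.Computes1Aware (threshold d) := by
  intro n hn
  refine ⟨fun h => sound n hn (by simpa [threshold] using h), fun h E hE hF => ?_⟩
  have hdn : d ≤ n := by simpa [threshold] using h
  have hreach : ∀ i, P.Reachable (P.initConfig n) (E i) := by
    intro i
    induction i with
    | zero => rw [hE.1]; exact Relation.ReflTransGen.refl
    | succ i ih => exact Relation.ReflTransGen.tail ih (hE.2 i)
  obtain ⟨C, hC⟩ := Finite.exists_infinite_fiber E
  have hC' : ∀ N : ℕ, ∃ i ≥ N, E i = C := by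
    intro N
    obtain ⟨i, hi, hN⟩ := (Set.infinite_coe_iff.1 hC).exists_gt N
    exact ⟨i, hN.le, hi⟩
  obtain ⟨i, -, hi⟩ := hC' 0
  obtain ⟨D, hCD, a, ha⟩ := complete n hdn C (hi ▸ hreach i)
  obtain ⟨F, hDF, -, hall⟩ := reach_all_qf P qf hdelta D a ha Finset.univ
  obtain ⟨i0, -, hi0⟩ := hF C F hC' (Relation.ReflTransGen.trans hCD hDF) 0
  refine ⟨i0, fun i hi b => ?_⟩
  have : E i b = qf := by
    induction i, hi using Nat.le_induction with
    | base => rw [hi0]; exact hall b (Finset.mem_univ b)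
    | succ k _ ih => exact trans_keep_qf P qf hdelta (hE.2 k) b ih
  rw [this]
  exact hqf
end

section
/- Fix k ≥ 1 and consider the protocol Π_k defined in the context. For every n ∈ ℤ⁺ with n < 2^{k+1} − 1, every configuration reachable from I_n contains no agent in the state F. -/
/-- States of the protocol `Π_k`: bankrupt `B`, final `F`, and `c i` ("holding `2^i` coins"). -/
inductive PkState (k : ℕ) where
  | B : PkState k
  | F : PkState k
  | c : Fin (k + 1) → PkState k
  deriving DecidableEq

/-- The transition function of `Π_k`. -/
def PkDelta (k : ℕ) : PkState k → PkState k → Set (PkState k × PkState k)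
  | .F, _ => {(.F, .F)}
  | _, .F => {(.F, .F)}
  | .c i, .c j =>
      if i = j then
        if h : i.val = k then {(.F, .F)}
        else if i.val = k - 1 then
          {(.c ⟨i.val + 1, by have := i.isLt; omega⟩, .c ⟨0, by omega⟩)}
        else {(.c ⟨i.val + 1, by have := i.isLt; omega⟩, .B)}
      else {(.c i, .c j)}
  | q, q' => {(q, q')}

/-- The protocol `Π_k` (warm-up protocol for `d = 2^{k+1} - 1`). -/
def PiK (k : ℕ) : PopulationProtocol (PkState k) where
  Q0 := {q | q ≠ .F}
  Q1 := {.F}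
  qinit := .c ⟨0, by omega⟩
  delta := PkDelta k
  union_eq := by
    ext q; simp [Set.mem_union]; tauto
  inter_eq := by
    ext q; simp
  delta_nonempty := by
    intro q1 q2
    cases q1 <;> cases q2 <;> simp only [PkDelta] <;>
      first
      | (split_ifs <;> exact Set.singleton_nonempty _)
      | exact Set.singleton_nonempty _

def pkVal (k : ℕ) : PkState k → ℕ
  | .B => 0
  | .F => 0
  | .c i => if i.val = k then 2 ^ k - 1 else 2 ^ i.val

theorem pkVal_c (k : ℕ) (i : Fin (k + 1)) :
    pkVal k (.c i) = if i.val = k then 2 ^ k - 1 else 2 ^ i.val := rfl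

theorem pkVal_B (k : ℕ) : pkVal k .B = 0 := rfl

theorem sum_split {n : ℕ} (f : Fin n → ℕ) (i j : Fin n) (hij : i ≠ j) :
    ∑ x, f x = f i + f j + ∑ x ∈ (Finset.univ.erase i).erase j, f x := by
  rw [← Finset.add_sum_erase Finset.univ f (Finset.mem_univ i),
    ← Finset.add_sum_erase (Finset.univ.erase i) f (a := j) (by simp [hij.symm])]
  ring

def pkInv (k n : ℕ) (C : Fin n → PkState k) : Prop :=
  (∀ i, C i ≠ PkState.F) ∧ ∑ x, pkVal k (C x) = n ∧
    ∀ i j, C i = .c (Fin.last k) → C j = .c (Fin.last k) → i = j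

theorem pkInv_step (k : ℕ) (hk : 1 ≤ k) (n : ℕ) (hlt : n < 2 ^ (k + 1) - 1)
    (C D : Fin n → PkState k) (hC : pkInv k n C) (h : (PiK k).Transition C D) :
    pkInv k n D := by
  obtain ⟨hF, hS, hU⟩ := hC
  obtain ⟨i, j, hij, hd, hr⟩ := h
  -- trivial transitions
  have triv : D i = C i → D j = C j → pkInv k n D := by
    intro h1 h2
    have : D = C := by
      funext x
      by_cases hx : x = i
      · rw [hx, h1]
      · by_cases hy : x = j
        · rw [hy, h2]
        · exact hr x hx hy
    rw [this]; exact ⟨hF, hS, hU⟩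
  have hrest : ∑ x ∈ (Finset.univ.erase i).erase j, pkVal k (D x)
      = ∑ x ∈ (Finset.univ.erase i).erase j, pkVal k (C x) := by
    apply Finset.sum_congr rfl
    intro x hx
    simp only [Finset.mem_erase, Finset.mem_univ, and_true] at hx
    rw [hr x hx.2 hx.1]
  have hSC := sum_split (fun x => pkVal k (C x)) i j hij
  have hSD := sum_split (fun x => pkVal k (D x)) i j hij
  have h2k : 2 ^ k = 2 * 2 ^ (k - 1) := by
    obtain ⟨m, rfl⟩ : ∃ m, k = m + 1 := ⟨k - 1, by omega⟩
    simp [pow_succ]; ring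
  have hpos : 0 < 2 ^ (k - 1) := by positivity
  have hpk : 2 ^ (k + 1) = 2 * 2 ^ k := by ring
  change (D i, D j) ∈ PkDelta k (C i) (C j) at hd
  rcases hCi : C i with _ | _ | a
  · rcases hCj : C j with _ | _ | b
    · rw [hCi, hCj] at hd
      simp only [PkDelta, Set.mem_singleton_iff, Prod.mk.injEq] at hd
      exact triv (hd.1.trans hCi.symm) (hd.2.trans hCj.symm)
    · exact absurd hCj (hF j)
    · rw [hCi, hCj] at hd
      simp only [PkDelta, Set.mem_singleton_iff, Prod.mk.injEq] at hd
      exact triv (hd.1.trans hCi.symm) (hd.2.trans hCj.symm)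
  · exact absurd hCi (hF i)
  · rcases hCj : C j with _ | _ | b
    · rw [hCi, hCj] at hd
      simp only [PkDelta, Set.mem_singleton_iff, Prod.mk.injEq] at hd
      exact triv (hd.1.trans hCi.symm) (hd.2.trans hCj.symm)
    · exact absurd hCj (hF j)
    · rw [hCi, hCj] at hd
      simp only [PkDelta] at hd
      split_ifs at hd with hab hak hak1
      · subst hab
        have : a = Fin.last k := Fin.ext hak
        subst this
        exact absurd (hU i j hCi hCj) hij
      · subst hab
        simp only [Set.mem_singleton_iff, Prod.mk.injEq] at hd
        obtain ⟨hDi, hDj⟩ := hd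
        have hnl : ∀ l, l ≠ i → l ≠ j → C l ≠ .c (Fin.last k) := by
          intro l hli hlj hl
          have := Finset.single_le_sum (f := fun x => pkVal k (C x)) (fun _ _ => Nat.zero_le _)
            (show l ∈ (Finset.univ.erase i).erase j by simp [hli, hlj])
          simp only [hl, pkVal_c, Fin.val_last, if_true] at this
          rw [hCi, hCj] at hSC
          simp only [pkVal_c, pkVal_B, if_neg hak] at hSC
          rw [hak1] at hSC
          omega
        have hDjl : D j ≠ .c (Fin.last k) := by
          rw [hDj]; intro h
          have := congrArg Fin.val (PkState.c.inj h)
          simp at this; omega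
        have huni : ∀ x, D x = .c (Fin.last k) → x = i := by
          intro x hx
          by_contra hxi
          by_cases hxj : x = j
          · exact hDjl (hxj ▸ hx)
          · exact hnl x hxi hxj (hr x hxi hxj ▸ hx)
        refine ⟨?_, ?_, fun x y hx hy => (huni x hx).trans (huni y hy).symm⟩
        · intro x
          by_cases hx : x = i
          · rw [hx, hDi]; simp
          · by_cases hy : x = j
            · rw [hy, hDj]; simp
            · rw [hr x hx hy]; exact hF x
        · rw [hCi, hCj] at hSC
          rw [hDi, hDj] at hSD
          have e1 : a.val + 1 = k := by omega
          have e2 : ¬ (0 = k) := by omega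
          simp only [pkVal_c, pkVal_B, if_neg hak] at hSC
          simp only [pkVal_c, pkVal_B, if_pos e1, if_neg e2, pow_zero] at hSD
          rw [hak1] at hSC
          omega
      · subst hab
        simp only [Set.mem_singleton_iff, Prod.mk.injEq] at hd
        obtain ⟨hDi, hDj⟩ := hd
        have e1 : ¬ (a.val + 1 = k) := by omega
        have huni : ∀ x, D x = .c (Fin.last k) → C x = .c (Fin.last k) := by
          intro x hx
          by_cases hxi : x = i
          · rw [hxi, hDi] at hx
            exact absurd (congrArg Fin.val (PkState.c.inj hx)) e1
          · by_cases hxj : x = j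
            · rw [hxj, hDj] at hx
              exact absurd hx (by simp)
            · exact hr x hxi hxj ▸ hx
        refine ⟨?_, ?_, fun x y hx hy => hU x y (huni x hx) (huni y hy)⟩
        · intro x
          by_cases hx : x = i
          · rw [hx, hDi]; simp
          · by_cases hy : x = j
            · rw [hy, hDj]; simp
            · rw [hr x hx hy]; exact hF x
        · rw [hCi, hCj] at hSC
          rw [hDi, hDj] at hSD
          simp only [pkVal_c, pkVal_B, if_neg hak] at hSC
          simp only [pkVal_c, pkVal_B, if_neg e1, pow_succ] at hSD
          omega
      · simp only [Set.mem_singleton_iff, Prod.mk.injEq] at hd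
        exact triv (hd.1.trans hCi.symm) (hd.2.trans hCj.symm)

theorem PiK_sound (k : ℕ) (hk : 1 ≤ k) (n : ℕ) (hn : 0 < n)
    (hlt : n < 2 ^ (k + 1) - 1) (C : Fin n → PkState k)
    (h : (PiK k).Reachable ((PiK k).initConfig n) C) :
    ∀ i : Fin n, C i ≠ PkState.F := by
  have key : pkInv k n C := by
    induction h with
    | refl =>
      have e : ¬ (0 = k) := by omega
      refine ⟨fun i => ?_, ?_, fun i j hi _ => ?_⟩
      · simp [PopulationProtocol.initConfig, PiK]
      · simp [PopulationProtocol.initConfig, PiK, pkVal, e]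
      · exact absurd (congrArg Fin.val (PkState.c.inj hi)) e
    | tail _ hs ih => exact pkInv_step k hk n hlt _ _ ih hs
  exact key.1
end
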